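/- arXiv:2508.06469 — 2 statements merged into one kernel-verified Lean document; each statement's English description precedes it below -/
import Mathlib

section
/- Parametric approximation guarantee: for every nondecreasing c : [0,1] → ℝ, every Borel probability measure ν on ℝ with ∫|v| dν(v) < ∞, and every λ ∈ (0,1), one has u_B + u_S ≥ (2(1 − λ)/(1 + ln(1/λ))) · FB, where FB := ∫_ℝ ∫₀¹ max(v − c(q), 0) dq dν(v), u_B := ∫_ℝ sup_{p ∈ ℝ} ((v − p)·x(p)) dν(v), and u_S := ∫₀¹ sup_{p ∈ ℝ} ((p − c(q))·ν({v : v ≥ p})) dq. -/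
open MeasureTheory Set

/-- The probability that the seller (with cost curve `c` on quantiles in `[0,1]`)
accepts a price `p`: the Lebesgue measure of `{q ∈ [0,1] : c q ≤ p}`. -/
noncomputable def accProb (c : ℝ → ℝ) (p : ℝ) : ℝ :=
  (volume {q : ℝ | q ∈ Icc (0:ℝ) 1 ∧ c q ≤ p}).toReal

/-- First-best gains from trade, in expectation over the buyer value `v ∼ ν`. -/
noncomputable def FB (c : ℝ → ℝ) (ν : Measure ℝ) : ℝ :=
  ∫ v, (∫ q in (0:ℝ)..1, max (v - c q) 0) ∂ν

/-- The buyer's expected optimal proposer utility. -/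
noncomputable def uB (c : ℝ → ℝ) (ν : Measure ℝ) : ℝ :=
  ∫ v, (⨆ p : ℝ, (v - p) * accProb c p) ∂ν

/-- The seller's expected optimal proposer utility. -/
noncomputable def uS (c : ℝ → ℝ) (ν : Measure ℝ) : ℝ :=
  ∫ q in (0:ℝ)..1, ⨆ p : ℝ, (p - c q) * (ν {v : ℝ | p ≤ v}).toReal

/-- The optimal utility of a proposer of value `v` facing a responder whose cost `c a` is
distributed according to `m`. -/
noncomputable def proposerValue {α : Type*} [MeasurableSpace α] (m : Measure α) (c : α → ℝ)
    (v : ℝ) : ℝ :=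
  ⨆ p : ℝ, (v - p) * m.real {a | c a ≤ p}

/-- The expected gains from trade between a proposer of value `v` and a responder whose cost
`c a` is distributed according to `m`. -/
noncomputable def expectedGains {α : Type*} [MeasurableSpace α] (m : Measure α) (c : α → ℝ)
    (v : ℝ) : ℝ :=
  ∫ a, max (v - c a) 0 ∂m

/-- The uniform distribution on the unit interval. -/
noncomputable abbrev unif : Measure ℝ := volume.restrict (Ioo (0:ℝ) 1)

instance isProbabilityMeasure_unif : IsProbabilityMeasure unif :=
  ⟨by simp [unif]⟩

section proposer

variable {α : Type*} [MeasurableSpace α] {m : Measure α} [IsProbabilityMeasure m] {c : α → ℝ}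

lemma integrable_gains (hc : Integrable c m) (v : ℝ) :
    Integrable (fun a => max (v - c a) 0) m :=
  ((integrable_const v).sub hc).pos_part

lemma offer_le_expectedGains (hm : Measurable c) (hc : Integrable c m) (v p : ℝ) :
    (v - p) * m.real {a | c a ≤ p} ≤ expectedGains m c v := by
  have hs : MeasurableSet {a | c a ≤ p} := measurableSet_le hm measurable_const
  have h : ∫ a, {a | c a ≤ p}.indicator (fun _ => v - p) a ∂m ≤ expectedGains m c v := by
    refine integral_mono ((integrable_const _).indicator hs) (integrable_gains hc v) fun a => ?_
    by_cases ha : c a ≤ p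
    · simp only [indicator, mem_ofPred_eq, ha, if_true]
      exact le_max_of_le_left (by linarith)
    · simp [indicator, ha]
  rwa [integral_indicator_const _ hs, smul_eq_mul, mul_comm] at h

lemma bddAbove_offers (hm : Measurable c) (hc : Integrable c m) (v : ℝ) :
    BddAbove (range fun p : ℝ => (v - p) * m.real {a | c a ≤ p}) :=
  ⟨expectedGains m c v, by rintro _ ⟨p, rfl⟩; exact offer_le_expectedGains hm hc v p⟩

lemma offer_le_proposerValue (hm : Measurable c) (hc : Integrable c m) (v p : ℝ) :
    (v - p) * m.real {a | c a ≤ p} ≤ proposerValue m c v :=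
  le_ciSup (bddAbove_offers hm hc v) p

lemma proposerValue_nonneg (hm : Measurable c) (hc : Integrable c m) (v : ℝ) :
    0 ≤ proposerValue m c v := by
  simpa using offer_le_proposerValue hm hc v v

lemma proposerValue_le_expectedGains (hm : Measurable c) (hc : Integrable c m) (v : ℝ) :
    proposerValue m c v ≤ expectedGains m c v :=
  ciSup_le fun p => offer_le_expectedGains hm hc v p

lemma monotone_proposerValue (hm : Measurable c) (hc : Integrable c m) :
    Monotone (proposerValue m c) := fun v w hvw =>
  ciSup_mono (bddAbove_offers hm hc w) fun p =>
    mul_le_mul_of_nonneg_right (by linarith) measureReal_nonneg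

variable {β : Type*} [MeasurableSpace β] {n : Measure β} [IsProbabilityMeasure n] {g : β → ℝ}

lemma integrable_gains_prod (hc : Integrable c m) (hg : Integrable g n) :
    Integrable (fun z : β × α => max (g z.1 - c z.2) 0) (n.prod m) :=
  ((hg.comp_fst m).sub (hc.comp_snd n)).pos_part

lemma integrable_expectedGains (hc : Integrable c m) (hg : Integrable g n) :
    Integrable (fun b => expectedGains m c (g b)) n :=
  (integrable_gains_prod hc hg).integral_prod_left

lemma integrable_proposerValue (hm : Measurable c) (hc : Integrable c m) (hgm : Measurable g)
    (hg : Integrable g n) : Integrable (fun b => proposerValue m c (g b)) n := by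
  refine (integrable_expectedGains hc hg).mono'
    ((monotone_proposerValue hm hc).measurable.comp hgm).aestronglyMeasurable
    (Filter.Eventually.of_forall fun b => ?_)
  rw [Real.norm_of_nonneg (proposerValue_nonneg hm hc _)]
  exact proposerValue_le_expectedGains hm hc _

lemma integral_expectedGains_comm (hc : Integrable c m) (hg : Integrable g n) :
    ∫ b, expectedGains m c (g b) ∂n = ∫ a, expectedGains n (fun b => -g b) (-c a) ∂m := by
  have h := integral_integral_swap (f := fun b a => max (g b - c a) 0) (integrable_gains_prod hc hg)
  simp only [expectedGains]
  rw [h]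
  refine integral_congr_ae (Filter.Eventually.of_forall fun a =>
    integral_congr_ae (Filter.Eventually.of_forall fun b => ?_))
  simp only
  congr 1
  ring

end proposer

lemma proposerValue_map_neg {α : Type*} [MeasurableSpace α] (m : Measure α) {w : α → ℝ}
    (hw : Measurable w) (v : ℝ) :
    proposerValue (m.map w) (fun x => -x) v = proposerValue m (fun a => -w a) v := by
  simp only [proposerValue]
  refine iSup_congr fun p => ?_
  rw [map_measureReal_apply hw (measurableSet_le measurable_neg measurable_const)]
  rfl

lemma seller_sup_eq (ν : Measure ℝ) (s : ℝ) :
    (⨆ p : ℝ, (p - s) * (ν {v : ℝ | p ≤ v}).toReal) = proposerValue ν (fun x => -x) (-s) := by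
  rw [proposerValue, ← (Equiv.neg ℝ).iSup_comp]
  refine iSup_congr fun p => ?_
  have h : {v : ℝ | -v ≤ p} = {v | -p ≤ v} := by
    ext v
    simp only [mem_ofPred_eq, neg_le]
  rw [Equiv.neg_apply, h, Measure.real]
  ring

section quantile

variable {c : ℝ → ℝ}

lemma le_measureReal_unif (hc : MonotoneOn c (Ioo 0 1)) {q p : ℝ} (hq : q ∈ Ioo (0:ℝ) 1)
    (h : c q ≤ p) : q ≤ unif.real {a | c a ≤ p} := by
  have h1 : volume.real (Ioc 0 q) ≤ unif.real {a | c a ≤ p} := by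
    have hsub : Ioc 0 q ⊆ Ioo (0:ℝ) 1 := fun x hx => ⟨hx.1, hx.2.trans_lt hq.2⟩
    have : unif.real (Ioc 0 q) = volume.real (Ioc 0 q) := by
      rw [measureReal_restrict_apply measurableSet_Ioc, inter_eq_left.2 hsub]
    rw [← this]
    exact measureReal_mono fun x hx => (hc (hsub hx) hq hx.2).trans h
  simpa [hq.1.le] using h1

lemma measureReal_unif_le (hm : Measurable c) (hc : MonotoneOn c (Ioo 0 1)) {q p : ℝ}
    (hq : q ∈ Ioo (0:ℝ) 1) (h : p < c q) : unif.real {a | c a ≤ p} ≤ q := by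
  rw [measureReal_restrict_apply (measurableSet_le hm measurable_const)]
  have h1 : volume.real ({a | c a ≤ p} ∩ Ioo 0 1) ≤ volume.real (Ioc 0 q) := by
    refine measureReal_mono (fun x hx => ⟨hx.2.1, ?_⟩) (by simp)
    by_contra! hlt
    exact absurd (hc hq hx.2 hlt.le) (not_le.2 (lt_of_le_of_lt hx.1 h))
  simpa [hq.1.le] using h1

variable {l : ℝ}

/-- The surplus of a seller of quantile `q` who asks for the cost at quantile `q / l`, from a
buyer of value `v`. -/
noncomputable def scaledSurplus (c : ℝ → ℝ) (l v q : ℝ) : ℝ :=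
  if c (q / l) ≤ v then c (q / l) - c q else 0

lemma div_mem_unit (hl : l ∈ Ioo (0:ℝ) 1) {q : ℝ} (hq : q ∈ Ioo 0 l) : q / l ∈ Ioo (0:ℝ) 1 :=
  ⟨div_pos hq.1 hl.1, (div_lt_one hl.1).2 hq.2⟩

lemma le_div_self_of_unit (hl : l ∈ Ioo (0:ℝ) 1) {q : ℝ} (hq : 0 < q) : q ≤ q / l := by
  rw [le_div_iff₀ hl.1]; nlinarith [hl.2]

lemma gains_sub_scaled_le (hm : Measurable c) (hc : MonotoneOn c (Ioo 0 1))
    (hi : Integrable c unif) (hl : l ∈ Ioo (0:ℝ) 1) (v : ℝ) {q : ℝ} (hq : q ∈ Ioo (0:ℝ) 1) :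
    max (v - c q) 0 - (Ioo 0 l).indicator (fun q => max (v - c (q / l)) 0) q ≤
      (Ioo 0 l).indicator (scaledSurplus c l v) q +
        (Icc (l * unif.real {a | c a ≤ v}) (unif.real {a | c a ≤ v})).indicator
          (fun q => proposerValue unif c v * q⁻¹) q := by
  set X := unif.real {a | c a ≤ v} with hX
  have hB := proposerValue_nonneg hm hi v
  have hlast : 0 ≤ (Icc (l * X) X).indicator (fun q => proposerValue unif c v * q⁻¹) q := by
    by_cases h : q ∈ Icc (l * X) X
    · rw [indicator_of_mem h]; exact mul_nonneg hB (inv_nonneg.2 hq.1.le)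
    · rw [indicator_of_notMem h]
  have hval : c q ≤ v → max (v - c q) 0 ≤ proposerValue unif c v * q⁻¹ := fun h => by
    rw [max_eq_left (by linarith), ← div_eq_mul_inv, le_div_iff₀ hq.1]
    exact (mul_le_mul_of_nonneg_left (le_measureReal_unif hc hq le_rfl) (by linarith)).trans
      (offer_le_proposerValue hm hi v (c q))
  by_cases hql : q ∈ Ioo 0 l
  · have hd := div_mem_unit hl hql
    have hmono := hc hq hd (le_div_self_of_unit hl hq.1)
    rw [indicator_of_mem hql, indicator_of_mem hql]
    by_cases hv : c (q / l) ≤ v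
    · rw [scaledSurplus, if_pos hv, max_eq_left (by linarith), max_eq_left (by linarith)]
      linarith
    · rw [scaledSurplus, if_neg hv, max_eq_right (a := v - c (q / l)) (by linarith), sub_zero,
        zero_add]
      by_cases hcq : c q ≤ v
      · rw [indicator_of_mem]
        · exact hval hcq
        · refine ⟨?_, le_measureReal_unif hc hq hcq⟩
          have := measureReal_unif_le hm hc hd (not_le.1 hv)
          rw [le_div_iff₀ hl.1] at this
          linarith
      · rwa [max_eq_right (by linarith)]
  · rw [indicator_of_notMem hql, indicator_of_notMem hql, sub_zero, zero_add]
    have hlq : l ≤ q := by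
      by_contra! h
      exact hql ⟨hq.1, h⟩
    by_cases hcq : c q ≤ v
    · rw [indicator_of_mem]
      · exact hval hcq
      · refine ⟨?_, le_measureReal_unif hc hq hcq⟩
        have : X ≤ 1 := measureReal_le_one
        nlinarith [hl.1]
    · rwa [max_eq_right (by linarith)]

lemma integrableOn_comp_div (hl : l ∈ Ioo (0:ℝ) 1) {f : ℝ → ℝ} (hf : Integrable f unif) :
    IntegrableOn (fun q => f (q / l)) (Ioo 0 l) := by
  have h : IntervalIntegrable f volume 0 1 := by
    rw [intervalIntegrable_iff_integrableOn_Ioo_of_le zero_le_one]; exact hf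
  have h2 := h.comp_mul_right (c := l⁻¹)
  simp only [← div_eq_mul_inv, zero_div, one_div, inv_inv] at h2
  rw [ intervalIntegrable_iff_integrableOn_Ioo_of_le hl.1.le] at h2
  exact h2

lemma setIntegral_comp_div (hl : l ∈ Ioo (0:ℝ) 1) (f : ℝ → ℝ) :
    ∫ q in Ioo 0 l, f (q / l) = l * ∫ q, f q ∂unif := by
  have h := intervalIntegral.integral_comp_div (a := 0) (b := l) f hl.1.ne'
  rw [zero_div, div_self hl.1.ne', intervalIntegral.integral_of_le hl.1.le,
    intervalIntegral.integral_of_le zero_le_one, integral_Ioc_eq_integral_Ioo,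
    integral_Ioc_eq_integral_Ioo, smul_eq_mul] at h
  exact h

lemma integrableOn_inv_Icc (hl : l ∈ Ioo (0:ℝ) 1) {X : ℝ} (hX : 0 ≤ X) :
    IntegrableOn (fun q : ℝ => q⁻¹) (Icc (l * X) X) := by
  rcases hX.eq_or_lt with rfl | hX
  · simp
  · refine ContinuousOn.integrableOn_Icc (continuousOn_inv₀.mono fun x hx => ?_)
    exact (lt_of_lt_of_le (mul_pos hl.1 hX) hx.1).ne'

lemma setIntegral_inv_Icc_le (hl : l ∈ Ioo (0:ℝ) 1) {X : ℝ} (hX : 0 ≤ X) :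
    ∫ q in Icc (l * X) X, q⁻¹ ≤ Real.log (1 / l) := by
  have hlog : 0 ≤ Real.log (1 / l) := Real.log_nonneg ((one_le_div hl.1).2 hl.2.le)
  rcases hX.eq_or_lt with rfl | hX
  · simpa using hlog
  · rw [integral_Icc_eq_integral_Ioc, ← intervalIntegral.integral_of_le (by nlinarith [hl.2]),
      integral_inv_of_pos (mul_pos hl.1 hX) hX]
    refine le_of_eq ?_
    congr 1
    field_simp

lemma measurable_scaledSurplus (hm : Measurable c) :
    Measurable (fun z : ℝ × ℝ => scaledSurplus c l z.1 z.2) :=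
  Measurable.ite (measurableSet_le (by fun_prop) (by fun_prop)) (by fun_prop) (by fun_prop)

lemma norm_scaledSurplus_le (v q : ℝ) :
    ‖scaledSurplus c l v q‖ ≤ ‖c (q / l) - c q‖ := by
  unfold scaledSurplus
  split_ifs
  · exact le_rfl
  · simp

lemma integrableOn_scaled_sub (hi : Integrable c unif) (hl : l ∈ Ioo (0:ℝ) 1) :
    IntegrableOn (fun q => c (q / l) - c q) (Ioo 0 l) :=
  (integrableOn_comp_div hl hi).sub
    (IntegrableOn.mono_set (t := Ioo 0 1) hi (Ioo_subset_Ioo_right hl.2.le))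

lemma integrableOn_scaledSurplus (hm : Measurable c) (hi : Integrable c unif)
    (hl : l ∈ Ioo (0:ℝ) 1) (v : ℝ) : IntegrableOn (scaledSurplus c l v) (Ioo 0 l) :=
  Integrable.mono (integrableOn_scaled_sub hi hl)
    ((measurable_scaledSurplus hm).comp measurable_prodMk_left).aestronglyMeasurable
    (Filter.Eventually.of_forall fun q => norm_scaledSurplus_le v q)

lemma restrict_unif_Ioo (hl : l ∈ Ioo (0:ℝ) 1) :
    unif.restrict (Ioo 0 l) = volume.restrict (Ioo 0 l) := by
  rw [Measure.restrict_restrict measurableSet_Ioo,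
    inter_eq_left.2 (Ioo_subset_Ioo_right hl.2.le)]

lemma expectedGains_le (hm : Measurable c) (hc : MonotoneOn c (Ioo 0 1))
    (hi : Integrable c unif) (hl : l ∈ Ioo (0:ℝ) 1) (v : ℝ) :
    (1 - l) * expectedGains unif c v ≤
      Real.log (1 / l) * proposerValue unif c v + ∫ q in Ioo 0 l, scaledSurplus c l v q := by
  set X := unif.real {a | c a ≤ v} with hX
  have hX0 : 0 ≤ X := measureReal_nonneg
  have hB := proposerValue_nonneg hm hi v
  have i1 := integrable_gains hi v
  have i2 : Integrable ((Ioo 0 l).indicator fun q => max (v - c (q / l)) 0) unif := by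
    rw [integrable_indicator_iff measurableSet_Ioo, IntegrableOn, restrict_unif_Ioo hl]
    exact integrableOn_comp_div hl i1
  have i3 : Integrable ((Ioo 0 l).indicator (scaledSurplus c l v)) unif := by
    rw [integrable_indicator_iff measurableSet_Ioo, IntegrableOn, restrict_unif_Ioo hl]
    exact integrableOn_scaledSurplus hm hi hl v
  have i4' : Integrable ((Icc (l * X) X).indicator
      fun q => proposerValue unif c v * q⁻¹) volume := by
    rw [integrable_indicator_iff measurableSet_Icc]
    exact (integrableOn_inv_Icc hl hX0).const_mul _
  have i4 : Integrable ((Icc (l * X) X).indicator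
      fun q => proposerValue unif c v * q⁻¹) unif := i4'.restrict
  have key := setIntegral_mono_on (μ := volume) (s := Ioo 0 1) (i1.sub i2) (i3.add i4)
    measurableSet_Ioo fun q hq => gains_sub_scaled_le hm hc hi hl v hq
  simp only [Pi.sub_apply, Pi.add_apply] at key
  rw [integral_sub i1 i2, integral_add i3 i4, integral_indicator measurableSet_Ioo,
    integral_indicator measurableSet_Ioo, restrict_unif_Ioo hl,
    setIntegral_comp_div hl fun q => max (v - c q) 0] at key
  have hlast : ∫ q, (Icc (l * X) X).indicator (fun q => proposerValue unif c v * q⁻¹) q ∂unif ≤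
      Real.log (1 / l) * proposerValue unif c v := by
    calc _ ≤ ∫ q, (Icc (l * X) X).indicator (fun q => proposerValue unif c v * q⁻¹) q := by
          refine setIntegral_le_integral i4' (Filter.Eventually.of_forall fun q => ?_)
          refine indicator_nonneg (fun q hq => mul_nonneg hB (inv_nonneg.2 ?_)) q
          exact (mul_nonneg hl.1.le hX0).trans hq.1
      _ = proposerValue unif c v * ∫ q in Icc (l * X) X, q⁻¹ := by
          rw [integral_indicator measurableSet_Icc, integral_const_mul]
      _ ≤ _ := by
          rw [mul_comm]
          exact mul_le_mul_of_nonneg_right (setIntegral_inv_Icc_le hl hX0) hB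
  change (∫ q, max (v - c q) 0 ∂unif) - l * (∫ q, max (v - c q) 0 ∂unif) ≤ _ at key
  rw [expectedGains]
  linarith

lemma integral_scaledSurplus_le (hm : Measurable c) (hi : Integrable c unif)
    {ν : Measure ℝ} [IsProbabilityMeasure ν] (hν : Integrable (fun v : ℝ => v) ν)
    (hl : l ∈ Ioo (0:ℝ) 1) :
    Integrable (fun v => ∫ q in Ioo 0 l, scaledSurplus c l v q) ν ∧
    ∫ v, (∫ q in Ioo 0 l, scaledSurplus c l v q) ∂ν ≤
      ∫ q, proposerValue ν (fun x => -x) (-c q) ∂unif := by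
  have hprod : Integrable (fun z : ℝ × ℝ => scaledSurplus c l z.1 z.2)
      (ν.prod (volume.restrict (Ioo 0 l))) :=
    Integrable.mono ((integrableOn_scaled_sub hi hl).comp_snd ν)
      (measurable_scaledSurplus hm).aestronglyMeasurable
      (Filter.Eventually.of_forall fun z => norm_scaledSurplus_le z.1 z.2)
  refine ⟨hprod.integral_prod_left, ?_⟩
  have hpv := integrable_proposerValue (m := ν) (n := unif) measurable_neg hν.neg hm.neg hi.neg
  rw [integral_integral_swap (f := scaledSurplus c l) hprod]
  calc _ ≤ ∫ q in Ioo 0 l, proposerValue ν (fun x => -x) (-c q) := by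
        refine integral_mono hprod.integral_prod_right
          (IntegrableOn.mono_set (t := Ioo 0 1) hpv (Ioo_subset_Ioo_right hl.2.le)) fun q => ?_
        have h : ∫ v, scaledSurplus c l v q ∂ν =
            (-c q - -c (q / l)) * ν.real {v | -v ≤ -c (q / l)} := by
          have : (fun v => scaledSurplus c l v q) =
              {v : ℝ | -v ≤ -c (q / l)}.indicator fun _ => c (q / l) - c q := by
            ext v
            simp [scaledSurplus, indicator]
          rw [this, integral_indicator_const _ (measurableSet_le measurable_neg measurable_const),
            smul_eq_mul]
          ring
        simp only
        rw [h]
        exact offer_le_proposerValue measurable_neg hν.neg _ _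
    _ ≤ _ := setIntegral_mono_set hpv
        (Filter.Eventually.of_forall fun q => proposerValue_nonneg measurable_neg hν.neg _)
        (Ioo_subset_Ioo_right hl.2.le).eventuallyLE

/-- The gains from trade are bounded by a weighted sum of the two proposer utilities, the
responder costs `c` being parametrized by their quantile. -/
lemma integral_expectedGains_le (hm : Measurable c) (hc : MonotoneOn c (Ioo 0 1))
    (hi : Integrable c unif) {ν : Measure ℝ} [IsProbabilityMeasure ν]
    (hν : Integrable (fun v : ℝ => v) ν) (hl : l ∈ Ioo (0:ℝ) 1) :
    (1 - l) * ∫ v, expectedGains unif c v ∂ν ≤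
      Real.log (1 / l) * ∫ v, proposerValue unif c v ∂ν +
        ∫ q, proposerValue ν (fun x => -x) (-c q) ∂unif := by
  obtain ⟨hint, hle⟩ := integral_scaledSurplus_le hm hi hν hl
  have i1 := (integrable_proposerValue (m := unif) hm hi measurable_id hν).const_mul
    (Real.log (1 / l))
  have h := integral_mono ((integrable_expectedGains hi hν).const_mul (1 - l)) (i1.add hint)
    fun v => expectedGains_le hm hc hi hl v
  simp only [Pi.add_apply, id] at h i1
  rw [integral_add i1 hint, integral_const_mul, integral_const_mul] at h
  linarith

end quantile

/-- Every probability measure on the reals is the law of a nonincreasing function of a uniform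
variable. -/
lemma exists_antitoneOn_map_unif (ν : Measure ℝ) [IsProbabilityMeasure ν] :
    ∃ w : ℝ → ℝ, Measurable w ∧ AntitoneOn w (Ioo 0 1) ∧ unif.map w = ν := by
  classical
  have hanti : Antitone fun x => ν.real (Ici x) := fun x y hxy =>
    measureReal_mono (Ici_subset_Ici.2 hxy)
  have hbot : Filter.Tendsto (fun x => ν.real (Ici x)) Filter.atBot (nhds 1) := by
    have h := tendsto_measure_Ici_atBot ν
    rw [measure_univ] at h
    exact (ENNReal.tendsto_toReal ENNReal.one_ne_top).comp h
  have htop : Filter.Tendsto (fun x => ν.real (Ici x)) Filter.atTop (nhds 0) := by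
    have h := tendsto_measure_iInter_atTop (μ := ν) (s := fun x : ℝ => Ici x)
      (fun _ => measurableSet_Ici.nullMeasurableSet) (fun x y hxy => Ici_subset_Ici.2 hxy)
      ⟨0, measure_ne_top _ _⟩
    have he : ⋂ x : ℝ, Ici x = ∅ := by
      ext y
      simp only [mem_iInter, mem_Ici, mem_empty_iff_false, iff_false, not_forall, not_le]
      exact exists_gt y
    rw [he, measure_empty] at h
    exact (ENNReal.tendsto_toReal ENNReal.zero_ne_top).comp h
  let w : ℝ → ℝ := fun r => if r ∈ Ioo (0:ℝ) 1 then sSup {x | r ≤ ν.real (Ici x)} else 0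
  have hgal : ∀ r ∈ Ioo (0:ℝ) 1, ∀ x, x ≤ w r ↔ r ≤ ν.real (Ici x) := by
    intro r hr x
    have hw : w r = sSup {x | r ≤ ν.real (Ici x)} := if_pos hr
    have hne : {x | r ≤ ν.real (Ici x)}.Nonempty :=
      ((hbot.eventually (lt_mem_nhds hr.2)).exists).imp fun _ h => h.le
    obtain ⟨b, hb⟩ := (htop.eventually (gt_mem_nhds hr.1)).exists
    have hbdd : BddAbove {x | r ≤ ν.real (Ici x)} := by
      refine ⟨b, fun y hy => ?_⟩
      by_contra! hlt
      exact absurd (hanti hlt.le) (not_le.2 (lt_of_lt_of_le hb hy))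
    refine ⟨fun hx => ?_, fun hx => hw ▸ le_csSup hbdd hx⟩
    have hlt : ∀ y < x, r ≤ ν.real (Ici y) := fun y hy => by
      obtain ⟨z, hz, hyz⟩ := exists_lt_of_lt_csSup hne (hw ▸ hy.trans_le hx)
      exact le_trans hz (hanti hyz.le)
    obtain ⟨u, hu, hux, hut⟩ := exists_seq_strictMono_tendsto x
    have h := tendsto_measure_iInter_atTop (μ := ν) (s := fun k : ℕ => Ici (u k))
      (fun _ => measurableSet_Ici.nullMeasurableSet)
      (fun i j hij => Ici_subset_Ici.2 (hu.monotone hij)) ⟨0, measure_ne_top _ _⟩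
    have he : ⋂ k : ℕ, Ici (u k) = Ici x := by
      ext y
      simp only [mem_iInter, mem_Ici]
      exact ⟨fun h => le_of_tendsto' hut h, fun h k => (hux k).le.trans h⟩
    rw [he] at h
    have h' := (ENNReal.tendsto_toReal (measure_ne_top ν (Ici x))).comp h
    exact ge_of_tendsto' h' fun k => hlt (u k) (hux k)
  have hmeas : Measurable w := by
    refine measurable_of_Ici fun x => ?_
    have : w ⁻¹' Ici x = (Ioo 0 1 ∩ Iic (ν.real (Ici x))) ∪ ((Ioo 0 1)ᶜ ∩ {_r | x ≤ 0}) := by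
      ext r
      by_cases hr : r ∈ Ioo (0:ℝ) 1
      · simp only [mem_preimage, mem_Ici, hgal r hr, mem_union, mem_inter_iff, mem_compl_iff, hr,
          mem_Iic, not_true, false_and, or_false, true_and]
      · simp only [mem_preimage, mem_Ici, w, hr, if_false, mem_union, mem_inter_iff, mem_compl_iff,
          not_false_iff, false_and, false_or, true_and, mem_ofPred_eq]
    rw [this]
    exact (measurableSet_Ioo.inter measurableSet_Iic).union
      (measurableSet_Ioo.compl.inter (MeasurableSet.const _))
  refine ⟨w, hmeas, fun r hr s hs hrs => ?_, ?_⟩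
  · exact (hgal r hr _).2 (hrs.trans ((hgal s hs _).1 le_rfl))
  · have : IsProbabilityMeasure (unif.map w) := Measure.isProbabilityMeasure_map hmeas.aemeasurable
    refine Measure.ext_of_Ici _ _ fun x => ?_
    rw [Measure.map_apply hmeas measurableSet_Ici,
      Measure.restrict_apply (hmeas measurableSet_Ici)]
    have hset : w ⁻¹' Ici x ∩ Ioo 0 1 = Ioo 0 1 ∩ Iic (ν.real (Ici x)) := by
      ext r
      constructor
      · rintro ⟨h, hr⟩
        exact ⟨hr, (hgal r hr x).1 h⟩
      · rintro ⟨hr, h⟩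
        exact ⟨(hgal r hr x).2 h, hr⟩
    have hae : (Ioo 0 1 ∩ Iic (ν.real (Ici x)) : Set ℝ) =ᵐ[volume] Ioc 0 (ν.real (Ici x)) := by
      have h1 : (Ioc 0 1 ∩ Iic (ν.real (Ici x)) : Set ℝ) = Ioc 0 (ν.real (Ici x)) := by
        rw [Ioc_inter_Iic, min_eq_right measureReal_le_one]
      rw [← h1]
      exact Ioo_ae_eq_Ioc.inter (Filter.EventuallyEq.refl _ _)
    rw [hset, measure_congr hae, Real.volume_Ioc, sub_zero, ofReal_measureReal]

lemma accProb_eq {c d : ℝ → ℝ} (h : EqOn d c (Icc 0 1)) (p : ℝ) :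
    accProb c p = unif.real {a | d a ≤ p} := by
  have hset : {q : ℝ | q ∈ Icc (0:ℝ) 1 ∧ c q ≤ p} = {a | d a ≤ p} ∩ Icc 0 1 := by
    ext q
    constructor
    · rintro ⟨hq, hp⟩
      exact ⟨(h hq).trans_le hp, hq⟩
    · rintro ⟨hp, hq⟩
      exact ⟨hq, (h hq).symm.trans_le hp⟩
  rw [accProb, hset, unif, restrict_Ioo_eq_restrict_Icc, Measure.real,
    Measure.restrict_apply' measurableSet_Icc]

lemma intervalIntegral_eq_unif {f g : ℝ → ℝ} (h : EqOn f g (Icc 0 1)) :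
    ∫ q in (0:ℝ)..1, f q = ∫ q, g q ∂unif := by
  rw [intervalIntegral.integral_of_le zero_le_one, integral_Ioc_eq_integral_Ioo]
  exact setIntegral_congr_fun measurableSet_Ioo fun q hq => h (Ioo_subset_Icc_self hq)

theorem stmt8 (c : ℝ → ℝ) (hc : MonotoneOn c (Icc (0:ℝ) 1))
    (ν : Measure ℝ) [IsProbabilityMeasure ν]
    (hν : Integrable (fun v : ℝ => v) ν)
    (l : ℝ) (hl : l ∈ Ioo (0:ℝ) 1) :
    uB c ν + uS c ν ≥ (2 * (1 - l) / (1 + Real.log (1 / l))) * FB c ν := by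
  obtain ⟨d, hd, hdc⟩ : ∃ d : ℝ → ℝ, Monotone d ∧ EqOn d c (Icc 0 1) :=
    ⟨IccExtend zero_le_one (domRestrict (Icc (0:ℝ) 1) c),
      (monotoneOn_iff_monotone.1 hc).IccExtend _,
      fun q hq => by rw [IccExtend_of_mem _ _ hq, domRestrict_apply]⟩
  have hdi : Integrable d unif :=
    ((hd.monotoneOn (Icc 0 1)).integrableOn_isCompact isCompact_Icc).mono_set Ioo_subset_Icc_self
  have hFB : FB c ν = ∫ v, expectedGains unif d v ∂ν := by
    refine integral_congr_ae (Filter.Eventually.of_forall fun v => ?_)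
    exact intervalIntegral_eq_unif fun q hq => by simp only [hdc hq]
  have huB : uB c ν = ∫ v, proposerValue unif d v ∂ν := by
    refine integral_congr_ae (Filter.Eventually.of_forall fun v => ?_)
    exact iSup_congr fun p => by rw [accProb_eq hdc]
  have huS : uS c ν = ∫ q, proposerValue ν (fun x => -x) (-d q) ∂unif :=
    intervalIntegral_eq_unif fun q hq => by simp only [seller_sup_eq, hdc hq]
  have h1 := integral_expectedGains_le hd.measurable (hd.monotoneOn _) hdi hν hl
  rw [← hFB, ← huB, ← huS] at h1
  obtain ⟨w, hwm, hwa, rfl⟩ := exists_antitoneOn_map_unif ν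
  have hwi : Integrable w unif := hν.comp_measurable hwm
  have : IsProbabilityMeasure (unif.map fun q => -d q) :=
    Measure.isProbabilityMeasure_map hd.measurable.neg.aemeasurable
  have hdn : Integrable (fun v : ℝ => v) (unif.map fun q => -d q) :=
    (integrable_map_measure aestronglyMeasurable_id hd.measurable.neg.aemeasurable).2 hdi.neg
  have h2 := integral_expectedGains_le hwm.neg hwa.neg hwi.neg hdn hl
  have hsm : ∀ (n : Measure ℝ) [IsProbabilityMeasure n] (g : ℝ → ℝ), Measurable g →
      Integrable g n → ∀ k : ℝ → ℝ, Measurable k →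
      ∫ v, proposerValue n g v ∂(unif.map k) = ∫ q, proposerValue n g (k q) ∂unif :=
    fun n _ g hgm hg k hk => integral_map hk.aemeasurable
      (monotone_proposerValue hgm hg).measurable.aestronglyMeasurable
  have hem : ∀ (g k : ℝ → ℝ), Integrable g unif → Measurable g → Measurable k →
      ∫ v, expectedGains unif g v ∂(unif.map k) = ∫ q, expectedGains unif g (k q) ∂unif :=
    fun g k hg hgm hk => integral_map hk.aemeasurable
      (StronglyMeasurable.integral_prod_right (f := fun v a => max (v - g a) 0)
        (by fun_prop : Measurable fun z : ℝ × ℝ => max (z.1 - g z.2) 0).stronglyMeasurable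
        ).aestronglyMeasurable
  rw [hem _ _ hdi hd.measurable hwm, integral_expectedGains_comm hdi hwi] at hFB
  rw [hsm _ _ hd.measurable hdi _ hwm] at huB
  simp only [proposerValue_map_neg unif hwm] at huS
  rw [hem _ (fun q => -d q) hwi.neg hwm.neg hd.measurable.neg,
    hsm _ _ hwm.neg hwi.neg (fun q => -d q) hd.measurable.neg] at h2
  simp only [Pi.neg_def, proposerValue_map_neg unif (w := fun q => -d q) hd.measurable.neg,
    neg_neg] at h2
  rw [← hFB, ← huS, ← huB] at h2
  have hlog : 0 ≤ Real.log (1 / l) := Real.log_nonneg ((one_le_div hl.1).2 hl.2.le)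
  rw [ge_iff_le, div_mul_eq_mul_div, div_le_iff₀ (by linarith)]
  linarith
end

section
/- Main theorem (3.15-approximation, welfare form): for every nondecreasing c : [0,1] → ℝ and every Borel probability measure ν on ℝ with ∫|v| dν(v) < ∞, the expected gains from trade of the random proposer mechanism satisfy (u_B + u_S)/2 ≥ FB / 3.15, where FB := ∫_ℝ ∫₀¹ max(v − c(q), 0) dq dν(v), u_B := ∫_ℝ sup_{p ∈ ℝ} ((v − p)·x(p)) dν(v), and u_S := ∫₀¹ sup_{p ∈ ℝ} ((p − c(q))·ν({v : v ≥ p})) dq. -/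
open MeasureTheory Set

lemma psi_head {κ ρ σ α W h e : ℝ} (hκ : 0 < κ) (hκ1 : κ ≤ 1) (hα : 0 < α) (hρ : 0 ≤ ρ)
    (hσ : σ = κ + ρ) (he : 0 ≤ e)
    (hmono : (W - α / σ) * (e ^ 2 - h ^ 2) ≤ 0) :
    min 0 (1 - κ * σ / (4 * α)) - ρ * (W - α / σ) * h ^ 2
      ≤ min e 1 - κ * e + α * e ^ 2 - ρ * W * e ^ 2 := by
  have hσ0 : 0 < σ := by linarith
  have key : min 0 (1 - κ * σ / (4 * α)) ≤ min e 1 - κ * e + (α * κ / σ) * e ^ 2 := by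
    rcases le_total e 1 with h1 | h1
    · rw [min_eq_left h1]
      have : 0 ≤ (α * κ / σ) * e ^ 2 := by positivity
      refine (min_le_left _ _).trans ?_
      nlinarith
    · rw [min_eq_right h1]
      refine (min_le_right _ _).trans ?_
      have : κ * σ / (4 * α) - κ * e + (α * κ / σ) * e ^ 2
          = (α * κ / σ) * (e - σ / (2 * α)) ^ 2 := by field_simp; ring
      have : 0 ≤ (α * κ / σ) * (e - σ / (2 * α)) ^ 2 := by positivity
      linarith
  have h3 : α * κ / σ = α - ρ * (α / σ) := by
    rw [hσ] at hσ0 ⊢; field_simp; ring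
  rw [h3] at key
  nlinarith

lemma psi_mid {κ ρ σ α W e : ℝ} (hκ : 0 < κ) (hκ1 : κ ≤ 1) (hρ : 0 ≤ ρ) (hρα : ρ ≤ 1 - κ + α)
    (hσ : σ = κ + ρ) (hW0 : 0 < W) (hW1 : W ≤ 1) (hW : 2 * α ≤ σ * W)
    (he : 0 ≤ e) (hWe : W * e ≤ 1) :
    min 0 (1 - σ / W + α / W ^ 2) ≤ min e 1 - κ * e + α * e ^ 2 - ρ * W * e ^ 2 := by
  rcases le_total e 1 with h1 | h1
  · rw [min_eq_left h1]
    refine (min_le_left _ _).trans ?_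
    have : 0 ≤ e * (1 - κ + α * e - ρ * W * e) := by
      refine mul_nonneg he ?_
      have h2 : W * e ≤ e := by nlinarith
      have h3 : ρ * (W * e) ≤ ρ * e := mul_le_mul_of_nonneg_left h2 hρ
      by_cases h : ρ ≤ α
      · have := mul_le_mul_of_nonneg_right h he
        linarith
      · push Not at h
        have := mul_le_mul_of_nonneg_left h1 (sub_nonneg.2 h.le)
        linarith
    linarith
  · rw [min_eq_right h1]
    refine (min_le_right _ _).trans ?_
    obtain ⟨z, hz⟩ : ∃ z, z = 1 / W - e := ⟨_, rfl⟩
    have hz0 : 0 ≤ z := by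
      rw [hz, sub_nonneg, le_div_iff₀ hW0]; linarith
    have hs : (α - ρ * W) * (1 / W + e) ≤ κ := by
      by_cases h : α ≤ ρ * W
      · have : 0 ≤ 1 / W + e := by positivity
        nlinarith
      · push Not at h
        have h4 : 1 / W + e ≤ 2 / W := by
          have : e ≤ 1 / W := by linarith
          calc _ ≤ 1 / W + 1 / W := by linarith
            _ = _ := by ring
        calc _ ≤ (α - ρ * W) * (2 / W) := mul_le_mul_of_nonneg_left h4 (by linarith)
          _ ≤ κ := by
            rw [← mul_div_assoc, div_le_iff₀ hW0]; nlinarith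
    have e1 : 1 - κ * e + α * e ^ 2 - ρ * W * e ^ 2 - (1 - σ / W + α / W ^ 2)
        = z * (κ - (α - ρ * W) * (1 / W + e)) := by
      rw [hz, hσ]; field_simp; ring
    have : 0 ≤ z * (κ - (α - ρ * W) * (1 / W + e)) := mul_nonneg hz0 (by linarith)
    linarith

/-- The integrand whose positivity drives the main estimate. -/
noncomputable def psi (κ ρ α W e : ℝ) : ℝ := min e 1 - κ * e + α * e ^ 2 - ρ * W * e ^ 2

section Core

variable {η : ℝ → ℝ}

lemma antitone_sq (hη : Antitone η) (h0 : ∀ W, 0 ≤ η W) : Antitone fun W => η W ^ 2 :=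
  fun _ b hab => pow_le_pow_left₀ (h0 b) (hη hab) 2

lemma intervalIntegrable_id_mul_sq (hη : Antitone η) (h0 : ∀ W, 0 ≤ η W) (s t : ℝ) :
    IntervalIntegrable (fun W => W * η W ^ 2) volume s t :=
  (antitone_sq hη h0).intervalIntegrable.continuousOn_mul continuousOn_id

lemma antitone_min_one (hη : Antitone η) : Antitone fun W => min (η W) 1 :=
  fun _ _ hab => min_le_min_right _ (hη hab)

lemma intervalIntegrable_psi (hη : Antitone η) (h0 : ∀ W, 0 ≤ η W) (κ ρ α s t : ℝ) :
    IntervalIntegrable (fun W => psi κ ρ α W (η W)) volume s t := by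
  have h := (intervalIntegrable_id_mul_sq hη h0 s t).const_mul ρ
  simp only [← mul_assoc] at h
  exact (((antitone_min_one hη).intervalIntegrable.sub
    (hη.intervalIntegrable.const_mul κ)).add
    ((antitone_sq hη h0).intervalIntegrable.const_mul α)).sub h

lemma integral_psi (hη : Antitone η) (h0 : ∀ W, 0 ≤ η W) (κ ρ α s t : ℝ) :
    ∫ W in s..t, psi κ ρ α W (η W) = (∫ W in s..t, min (η W) 1) - κ * (∫ W in s..t, η W)
      + α * (∫ W in s..t, η W ^ 2) - ρ * ∫ W in s..t, W * η W ^ 2 := by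
  have h1 : IntervalIntegrable (fun W => min (η W) 1) volume s t :=
    (antitone_min_one hη).intervalIntegrable
  have h2 : IntervalIntegrable (fun W => κ * η W) volume s t :=
    hη.intervalIntegrable.const_mul κ
  have h3 : IntervalIntegrable (fun W => α * η W ^ 2) volume s t :=
    (antitone_sq hη h0).intervalIntegrable.const_mul α
  have h4 := (intervalIntegrable_id_mul_sq hη h0 s t).const_mul ρ
  simp only [psi, mul_assoc]
  rw [intervalIntegral.integral_sub ((h1.sub h2).add h3) h4,
    intervalIntegral.integral_add (h1.sub h2) h3, intervalIntegral.integral_sub h1 h2]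
  simp only [intervalIntegral.integral_const_mul]

lemma integral_quadratic_inv {σ α s t : ℝ} (hs : 0 < s) (hst : s ≤ t) :
    ∫ W in s..t, (1 - σ / W + α / W ^ 2)
      = (t - s) - σ * Real.log (t / s) + α * (1 / s - 1 / t) := by
  have ht : 0 < t := hs.trans_le hst
  have hpos : ∀ W ∈ uIcc s t, 0 < W := fun W hW => by
    rw [uIcc_of_le hst] at hW; exact hs.trans_le hW.1
  have hd : ∀ W ∈ uIcc s t,
      HasDerivAt (fun W => W - σ * Real.log W - α * W⁻¹) (1 - σ / W + α / W ^ 2) W := by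
    intro W hW
    have h := hpos W hW
    have := ((hasDerivAt_id W).sub ((Real.hasDerivAt_log h.ne').const_mul σ)).sub
      ((hasDerivAt_inv h.ne').const_mul α)
    exact this.congr_deriv (by field_simp; ring)
  rw [intervalIntegral.integral_eq_sub_of_hasDerivAt hd, Real.log_div ht.ne' hs.ne']
  · field_simp
    ring
  · apply ContinuousOn.intervalIntegrable
    have : ∀ W ∈ uIcc s t, W ≠ 0 := fun W hW => (hpos W hW).ne'
    fun_prop (disch := aesop)

lemma le_integral_psi_head (hη : Antitone η) (h0 : ∀ W, 0 ≤ η W)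
    (hW1 : ∀ W ∈ Icc (0 : ℝ) 1, W * η W ≤ 1) {κ ρ σ α φ : ℝ} (hκ : 0 < κ) (hκ1 : κ ≤ 1)
    (hρ : 0 ≤ ρ) (hρα : ρ ≤ 1 - κ + α) (hα : 0 < α) (hσ : σ = κ + ρ)
    (hφ : φ * (σ - φ) = α) (hφ1 : φ ≤ 1) (hφσ : 2 * α / σ ≤ φ) (hφσ' : σ - φ ≤ 2 * α / σ) :
    (2 * α / σ) * min 0 (1 - κ * σ / (4 * α)) + ((φ - 2 * α / σ)
      - σ * Real.log (φ / (2 * α / σ)) + α * (1 / (2 * α / σ) - 1 / φ))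
      ≤ ∫ W in (0 : ℝ)..1, psi κ ρ α W (η W) := by
  have hσ0 : 0 < σ := by linarith
  have hs : 0 < 2 * α / σ := by positivity
  set s := 2 * α / σ with hsdef
  have hI := intervalIntegrable_psi hη h0 κ ρ α
  rw [← intervalIntegral.integral_add_adjacent_intervals (hI 0 s) (hI s 1),
    ← intervalIntegral.integral_add_adjacent_intervals (hI s φ) (hI φ 1)]
  have hA : s * min 0 (1 - κ * σ / (4 * α)) ≤ ∫ W in (0 : ℝ)..s, psi κ ρ α W (η W) := by
    have : ∫ W in (0 : ℝ)..s, (min 0 (1 - κ * σ / (4 * α)) - ρ * (W - α / σ) * η (α / σ) ^ 2)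
        = s * min 0 (1 - κ * σ / (4 * α)) := by
      rw [intervalIntegral.integral_sub (by simp) (Continuous.intervalIntegrable (by fun_prop) _ _),
        intervalIntegral.integral_mul_const, intervalIntegral.integral_const_mul,
        intervalIntegral.integral_sub (by simp) (by simp)]
      simp [hsdef]
      left; right; field_simp; ring
    rw [← this]
    refine intervalIntegral.integral_mono_on hs.le
      (Continuous.intervalIntegrable (by fun_prop) _ _) (hI 0 s) fun W _ => ?_
    refine psi_head hκ hκ1 hα hρ hσ (h0 W) ?_
    rcases le_total W (α / σ) with h | h
    · exact mul_nonpos_of_nonpos_of_nonneg (by linarith)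
        (by linarith [antitone_sq hη h0 h])
    · exact mul_nonpos_of_nonneg_of_nonpos (by linarith)
        (by linarith [antitone_sq hη h0 h])
  have hq : ∀ W, 0 < W → 1 - σ / W + α / W ^ 2 = (W - φ) * (W - (σ - φ)) / W ^ 2 := by
    intro W hW
    rw [← hφ]; field_simp; ring
  have hmid : ∀ W, s ≤ W → W ≤ 1 → min 0 (1 - σ / W + α / W ^ 2) ≤ psi κ ρ α W (η W) := by
    intro W h1 h2
    have h3 := hs.trans_le h1
    refine psi_mid hκ hκ1 hρ hρα hσ h3 h2 ?_ (h0 W) (hW1 W ⟨h3.le, h2⟩)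
    rw [hsdef, div_le_iff₀ hσ0] at h1
    linarith
  have hB : (φ - s) - σ * Real.log (φ / s) + α * (1 / s - 1 / φ)
      ≤ ∫ W in s..φ, psi κ ρ α W (η W) := by
    rw [← integral_quadratic_inv hs hφσ]
    refine intervalIntegral.integral_mono_on hφσ ?_ (hI _ _) fun W hW => ?_
    · apply ContinuousOn.intervalIntegrable
      have : ∀ W ∈ uIcc s φ, W ≠ 0 := fun W hW => by
        rw [uIcc_of_le hφσ] at hW; exact (hs.trans_le hW.1).ne'
      fun_prop (disch := aesop)
    · refine le_trans (le_min ?_ le_rfl) (hmid W hW.1 (hW.2.trans hφ1))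
      rw [hq W (hs.trans_le hW.1)]
      exact div_nonpos_of_nonpos_of_nonneg (mul_nonpos_of_nonpos_of_nonneg
        (by linarith [hW.2]) (by linarith [hW.1])) (by positivity)
  have hC : 0 ≤ ∫ W in φ..1, psi κ ρ α W (η W) := by
    refine intervalIntegral.integral_nonneg hφ1 fun W hW => ?_
    refine le_trans (le_min le_rfl ?_) (hmid W (hφσ.trans hW.1) hW.2)
    rw [hq W (hs.trans_le (hφσ.trans hW.1))]
    exact div_nonneg (mul_nonneg (by linarith [hW.1]) (by linarith [hW.1])) (by positivity)
  linarith

lemma le_integral_psi_tail_of_le (hη : Antitone η) (h0 : ∀ W, 0 ≤ η W) {T : ℝ} (hT : 1 ≤ T)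
    (hW1 : ∀ W ∈ Icc (0 : ℝ) T, W * η W ≤ 1) {κ ρ α e : ℝ} (hρ : ρ = 1 - κ) (hα : 0 ≤ α)
    (hαρ : α ≤ ρ) (he : 0 ≤ e) (heT : e ≤ ∫ W in (1 : ℝ)..T, η W) :
    α * e * (1 - e) ≤ ∫ W in (1 : ℝ)..T, psi κ ρ α W (η W) := by
  have hI := intervalIntegrable_psi hη h0 κ ρ α
  have hcont : Continuous fun t => ∫ W in (1 : ℝ)..t, η W :=
    intervalIntegral.continuous_primitive (fun _ _ => hη.intervalIntegrable) 1
  obtain ⟨t, ht, hte⟩ := intermediate_value_Icc hT hcont.continuousOn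
    (show e ∈ Icc (∫ W in (1 : ℝ)..1, η W) (∫ W in (1 : ℝ)..T, η W) by simp [he, heT])
  have hpsi : ∀ W, 1 ≤ W → W ≤ T → psi κ ρ α W (η W)
      = ρ * (η W * (1 - W * η W)) + α * η W ^ 2 ∧ 0 ≤ η W * (1 - W * η W) := by
    intro W h1 h2
    have h3 := hW1 W ⟨by linarith, h2⟩
    have h4 : η W ≤ 1 := by nlinarith [h0 W]
    refine ⟨?_, mul_nonneg (h0 W) (by linarith)⟩
    rw [psi, min_eq_left h4, hρ]; ring
  rw [← intervalIntegral.integral_add_adjacent_intervals (hI 1 t) (hI t T)]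
  have hA : α * e * (1 - e) ≤ ∫ W in (1 : ℝ)..t, psi κ ρ α W (η W) := by
    have : α * e * (1 - e) = ∫ W in (1 : ℝ)..t, α * (1 - e) * η W := by
      rw [intervalIntegral.integral_const_mul]; simp only at hte; rw [hte]; ring
    rw [this]
    refine intervalIntegral.integral_mono_on ht.1 (hη.intervalIntegrable.const_mul _) (hI _ _)
      fun W hW => ?_
    obtain ⟨h1, h2⟩ := hpsi W hW.1 (hW.2.trans ht.2)
    have h3 : (W - 1) * η W ≤ e := by
      have h4 : ∫ W in (1 : ℝ)..W, η W ≤ e := by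
        rw [← hte]
        refine intervalIntegral.integral_mono_interval le_rfl hW.1 hW.2
          (Filter.Eventually.of_forall h0) hη.intervalIntegrable
      refine le_trans ?_ h4
      have h5 : ∫ _ in (1 : ℝ)..W, η W = (W - 1) * η W := by simp
      rw [← h5]
      exact intervalIntegral.integral_mono_on hW.1 (by simp) hη.intervalIntegrable
        fun s hs => hη hs.2
    have h6 := mul_le_mul_of_nonneg_right hαρ h2
    have h7 : α * (η W * (1 - e)) ≤ α * (η W * (1 - W * η W + η W)) :=
      mul_le_mul_of_nonneg_left (mul_le_mul_of_nonneg_left (by linarith) (h0 W)) hα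
    rw [h1]
    nlinarith
  have hB : 0 ≤ ∫ W in t..T, psi κ ρ α W (η W) := by
    refine intervalIntegral.integral_nonneg ht.2 fun W hW => ?_
    obtain ⟨h1, h2⟩ := hpsi W (ht.1.trans hW.1) hW.2
    rw [h1]
    have : 0 ≤ ρ := hα.trans hαρ
    positivity
  linarith

lemma le_integral_psi_tail_of_ge (hη : Antitone η) (h0 : ∀ W, 0 ≤ η W) {T : ℝ} (hT : 1 ≤ T)
    (hW1 : ∀ W ∈ Icc (0 : ℝ) T, W * η W ≤ 1) {κ ρ α e τ : ℝ} (hρ : ρ = 1 - κ + τ) (hα : 0 ≤ α)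
    (hρ0 : 0 ≤ ρ) (hτ : 0 ≤ τ) (heT : ∫ W in (1 : ℝ)..T, η W ≤ e) :
    -(τ * e) ≤ ∫ W in (1 : ℝ)..T, psi κ ρ α W (η W) := by
  have : -(τ * e) ≤ ∫ W in (1 : ℝ)..T, -τ * η W := by
    rw [intervalIntegral.integral_const_mul]
    nlinarith
  refine this.trans (intervalIntegral.integral_mono_on hT (hη.intervalIntegrable.const_mul _)
    (intervalIntegrable_psi hη h0 κ ρ α 1 T) fun W hW => ?_)
  have h3 := hW1 W ⟨by linarith [hW.1], hW.2⟩
  have h4 : η W ≤ 1 := by nlinarith [h0 W, hW.1]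
  have h5 : 0 ≤ ρ * (η W * (1 - W * η W)) :=
    mul_nonneg hρ0 (mul_nonneg (h0 W) (by linarith))
  have h6 : 0 ≤ α * η W ^ 2 := by positivity
  have h7 : psi κ ρ α W (η W) = -τ * η W + ρ * (η W * (1 - W * η W)) + α * η W ^ 2 := by
    rw [psi, min_eq_left h4, hρ]; ring
  linarith

lemma exists_le_integral_psi (hη : Antitone η) (h0 : ∀ W, 0 ≤ η W) {T : ℝ} (hT : 1 ≤ T)
    (hW1 : ∀ W ∈ Icc (0 : ℝ) T, W * η W ≤ 1) :
    ∃ ρ > 0, 8 / 25 / ρ - 1 ≤ ∫ W in (0 : ℝ)..T, psi (40 / 63) ρ (4 / 25) W (η W) := by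
  have hlog2 := Real.log_two_lt_d9
  have hW1' : ∀ W ∈ Icc (0 : ℝ) 1, W * η W ≤ 1 := fun W hW => hW1 W ⟨hW.1, hW.2.trans hT⟩
  rcases le_total (1 / 5) (∫ W in (1 : ℝ)..T, η W) with h | h
  · refine ⟨23 / 63, by norm_num, ?_⟩
    have hI := intervalIntegrable_psi hη h0 (40 / 63) (23 / 63) (4 / 25)
    rw [← intervalIntegral.integral_add_adjacent_intervals (hI 0 1) (hI 1 T)]
    have tail := le_integral_psi_tail_of_le hη h0 hT hW1 (κ := 40 / 63) (ρ := 23 / 63)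
      (α := 4 / 25) (by norm_num) (by norm_num) (by norm_num) (by norm_num) h
    have head := le_integral_psi_head hη h0 hW1' (κ := 40 / 63) (ρ := 23 / 63) (σ := 1)
      (α := 4 / 25) (φ := 4 / 5) (by norm_num) (by norm_num) (by norm_num) (by norm_num)
      (by norm_num) (by norm_num) (by norm_num) (by norm_num) (by norm_num) (by norm_num)
    have hlog : 3 * Real.log (5 / 2) ≤ 4 * Real.log 2 := by
      rw [← Real.log_rpow (by norm_num), ← Real.log_rpow (by norm_num)]
      exact Real.log_le_log (by norm_num) (by norm_num)
    norm_num at head tail hlog ⊢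
    linarith
  · refine ⟨31 / 70, by norm_num, ?_⟩
    have hI := intervalIntegrable_psi hη h0 (40 / 63) (31 / 70) (4 / 25)
    rw [← intervalIntegral.integral_add_adjacent_intervals (hI 0 1) (hI 1 T)]
    have tail := le_integral_psi_tail_of_ge hη h0 hT hW1 (κ := 40 / 63) (ρ := 31 / 70)
      (α := 4 / 25) (τ := 7 / 90) (by norm_num) (by norm_num) (by norm_num) (by norm_num) h
    have head := le_integral_psi_head hη h0 hW1' (κ := 40 / 63) (ρ := 31 / 70) (σ := 97 / 90)
      (α := 4 / 25) (φ := 9 / 10) (by norm_num) (by norm_num) (by norm_num) (by norm_num)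
      (by norm_num) (by norm_num) (by norm_num) (by norm_num) (by norm_num) (by norm_num)
    have hlog : 5 * Real.log (97 / 32) ≤ 8 * Real.log 2 := by
      rw [← Real.log_rpow (by norm_num), ← Real.log_rpow (by norm_num)]
      exact Real.log_le_log (by norm_num) (by norm_num)
    norm_num at head tail hlog ⊢
    linarith

/-- The one-dimensional inequality behind the approximation guarantee. -/
lemma antitone_integral_bound (hη : Antitone η) (h0 : ∀ W, 0 ≤ η W) {T : ℝ} (hT : 1 ≤ T)
    (hW1 : ∀ W ∈ Icc (0 : ℝ) T, W * η W ≤ 1) {b n : ℝ} (hb : b ^ 2 = 8 / 25) (hb0 : 0 < b)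
    (hJ : ∫ W in (0 : ℝ)..T, η W ^ 2 = 2 * n / b)
    (hJW : ∫ W in (0 : ℝ)..T, W * η W ^ 2 = n ^ 2) :
    40 / 63 * (∫ W in (0 : ℝ)..T, η W) ≤ (∫ W in (0 : ℝ)..T, min (η W) 1) + 1 - b * n := by
  obtain ⟨ρ, hρ, h⟩ := exists_le_integral_psi hη h0 hT hW1
  rw [integral_psi hη h0, hJ, hJW] at h
  have h1 : 4 / 25 * (2 * n / b) = b * n := by
    field_simp; rw [hb]; ring
  have h2 : 2 * (b * n) - ρ * n ^ 2 ≤ 8 / 25 / ρ := by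
    rw [le_div_iff₀ hρ, ← hb]
    nlinarith [sq_nonneg (b - ρ * n)]
  linarith

end Core

/-- The integral of the squared acceptance curve up to `v`. -/
noncomputable def sqMass (x : ℝ → ℝ) (a v : ℝ) : ℝ := ∫ s in a..v, x s ^ 2

/-- The double integral of the squared acceptance curve up to `v`. -/
noncomputable def sqMoment (x : ℝ → ℝ) (a v : ℝ) : ℝ := ∫ s in a..v, (v - s) * x s ^ 2

/-- The quantile threshold up to which the seller trades with value `v`. -/
noncomputable def threshold (x : ℝ → ℝ) (a b v : ℝ) : ℝ :=
  b * sqMass x a v / (2 * √(sqMoment x a v))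

section Curve

variable {x : ℝ → ℝ} {a b : ℝ}

lemma monotone_sq (hx : Monotone x) (hx0 : ∀ p, 0 ≤ x p) : Monotone fun p => x p ^ 2 :=
  fun p _ h => pow_le_pow_left₀ (hx0 p) (hx h) 2

lemma intervalIntegrable_sub_mul_sq (hx : Monotone x) (hx0 : ∀ p, 0 ≤ x p) (w s t : ℝ) :
    IntervalIntegrable (fun p => (w - p) * x p ^ 2) volume s t :=
  (monotone_sq hx hx0).intervalIntegrable.continuousOn_mul (by fun_prop)

lemma integral_eq_zero_of_zero_below {f : ℝ → ℝ} (hf : ∀ s < a, f s = 0) {s t : ℝ} (hs : s ≤ a)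
    (ht : t ≤ a) : ∫ p in s..t, f p = 0 := by
  have : ∫ p in s..t, f p = ∫ _ in s..t, (0 : ℝ) := by
    refine intervalIntegral.integral_congr_ae ?_
    have : ∀ᵐ p ∂(volume : Measure ℝ), p ≠ a := by
      simp [ae_iff]
    filter_upwards [this] with p hp h
    refine hf p (lt_of_le_of_ne ?_ hp)
    rw [mem_uIoc] at h
    rcases h with h | h
    · exact h.2.trans ht
    · exact h.2.trans hs
  simpa using this

lemma integral_from_below {f : ℝ → ℝ} (hf : ∀ s < a, f s = 0)
    (hI : ∀ s t, IntervalIntegrable f volume s t) {s : ℝ} (hs : s ≤ a) (v : ℝ) :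
    ∫ p in s..v, f p = ∫ p in a..v, f p := by
  rw [← intervalIntegral.integral_add_adjacent_intervals (hI s a) (hI a v),
    integral_eq_zero_of_zero_below hf hs le_rfl, zero_add]

lemma sqMass_add (hx : Monotone x) (hx0 : ∀ p, 0 ≤ x p) (v w : ℝ) :
    sqMass x a w = sqMass x a v + ∫ s in v..w, x s ^ 2 :=
  (intervalIntegral.integral_add_adjacent_intervals (monotone_sq hx hx0).intervalIntegrable
    (monotone_sq hx hx0).intervalIntegrable).symm

lemma sqMoment_add (hx : Monotone x) (hx0 : ∀ p, 0 ≤ x p) (v w : ℝ) :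
    sqMoment x a w = sqMoment x a v + (w - v) * sqMass x a v + ∫ s in v..w, (w - s) * x s ^ 2 := by
  have hI := intervalIntegrable_sub_mul_sq hx hx0
  rw [sqMoment, ← intervalIntegral.integral_add_adjacent_intervals (hI w a v) (hI w v w), sqMoment,
    sqMass, ← intervalIntegral.integral_const_mul,
    ← intervalIntegral.integral_add (hI v a v)
      ((monotone_sq hx hx0).intervalIntegrable.const_mul _)]
  congr 1
  refine intervalIntegral.integral_congr fun s _ => by ring

lemma sqMass_of_le (hxa : ∀ p < a, x p = 0) {v : ℝ} (hv : v ≤ a) : sqMass x a v = 0 :=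
  integral_eq_zero_of_zero_below (fun s hs => by simp [hxa s hs]) le_rfl hv

lemma sqMoment_of_le (hxa : ∀ p < a, x p = 0) {v : ℝ} (hv : v ≤ a) : sqMoment x a v = 0 :=
  integral_eq_zero_of_zero_below (fun s hs => by simp [hxa s hs]) le_rfl hv

lemma sqMass_nonneg (hxa : ∀ p < a, x p = 0) (v : ℝ) : 0 ≤ sqMass x a v := by
  rcases le_total v a with h | h
  · rw [sqMass_of_le hxa h]
  · exact intervalIntegral.integral_nonneg h fun s _ => sq_nonneg _

lemma sqMoment_nonneg (hxa : ∀ p < a, x p = 0) (v : ℝ) : 0 ≤ sqMoment x a v := by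
  rcases le_total v a with h | h
  · rw [sqMoment_of_le hxa h]
  · exact intervalIntegral.integral_nonneg h fun s hs =>
      mul_nonneg (by linarith [hs.2]) (sq_nonneg _)

lemma sqMoment_mono (hx : Monotone x) (hx0 : ∀ p, 0 ≤ x p) (hxa : ∀ p < a, x p = 0) :
    Monotone (sqMoment x a) := by
  intro v w h
  rw [sqMoment_add hx hx0 v w]
  have h1 : 0 ≤ ∫ s in v..w, (w - s) * x s ^ 2 := intervalIntegral.integral_nonneg h
    fun s hs => mul_nonneg (by linarith [hs.2]) (sq_nonneg _)
  have h2 : 0 ≤ (w - v) * sqMass x a v := mul_nonneg (by linarith) (sqMass_nonneg hxa v)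
  linarith

lemma sqMass_sq_le (hx : Monotone x) (hx0 : ∀ p, 0 ≤ x p) (hxa : ∀ p < a, x p = 0) (v : ℝ) :
    sqMass x a v ^ 2 ≤ 2 * x v ^ 2 * sqMoment x a v := by
  rcases le_total v a with h | h
  · simp [sqMass_of_le hxa h, sqMoment_of_le hxa h]
  have hM : sqMass x a v ≤ (v - a) * x v ^ 2 := by
    have : ∫ _ in a..v, x v ^ 2 = (v - a) * x v ^ 2 := by simp
    rw [← this]
    exact intervalIntegral.integral_mono_on h (monotone_sq hx hx0).intervalIntegrable (by simp)
      fun s hs => monotone_sq hx hx0 hs.2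
  rcases (sq_nonneg (x v)).eq_or_lt with hy | hy
  · have : sqMass x a v = 0 := le_antisymm (by simpa [← hy] using hM) (sqMass_nonneg hxa v)
    simp [this, ← hy]
  obtain ⟨y, hyd⟩ : ∃ y, y = x v ^ 2 := ⟨_, rfl⟩
  rw [← hyd] at hM hy ⊢
  obtain ⟨L, hL⟩ : ∃ L, L = sqMass x a v / y := ⟨_, rfl⟩
  have hML : sqMass x a v = L * y := by rw [hL]; field_simp
  have hL0 : 0 ≤ L := hL ▸ div_nonneg (sqMass_nonneg hxa v) hy.le
  have hLv : L ≤ v - a := by rw [hL, div_le_iff₀ hy]; exact hM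
  have hI := intervalIntegrable_sub_mul_sq hx hx0 (v - L)
  have e : sqMoment x a v - L * sqMass x a v = ∫ s in a..v, (v - L - s) * x s ^ 2 := by
    rw [sqMoment, sqMass, ← intervalIntegral.integral_const_mul,
      ← intervalIntegral.integral_sub (intervalIntegrable_sub_mul_sq hx hx0 v a v)
      ((monotone_sq hx hx0).intervalIntegrable.const_mul _)]
    refine intervalIntegral.integral_congr fun s _ => by ring
  rw [← intervalIntegral.integral_add_adjacent_intervals (hI a (v - L)) (hI (v - L) v)] at e
  have h1 : 0 ≤ ∫ s in a..(v - L), (v - L - s) * x s ^ 2 :=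
    intervalIntegral.integral_nonneg (by linarith) fun s hs =>
      mul_nonneg (by linarith [hs.2]) (sq_nonneg _)
  have h2 : -(y * L ^ 2 / 2) ≤ ∫ s in (v - L)..v, (v - L - s) * x s ^ 2 := by
    have : ∫ s in (v - L)..v, (v - L - s) * y = -(y * L ^ 2 / 2) := by
      rw [intervalIntegral.integral_mul_const,
        intervalIntegral.integral_sub (by simp) (by simp)]
      simp
      ring
    rw [← this]
    refine intervalIntegral.integral_mono_on (by linarith)
      (Continuous.intervalIntegrable (by fun_prop) _ _) (hI _ _) fun s hs => ?_
    have := monotone_sq hx hx0 hs.2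
    simp only [← hyd] at this
    nlinarith [hs.1]
  rw [hML] at e ⊢
  nlinarith

lemma integral_sub_mul_sq_le (hx : Monotone x) (hx0 : ∀ p, 0 ≤ x p) {v w : ℝ} (h : v ≤ w) :
    ∫ s in v..w, (w - s) * x s ^ 2 ≤ (w - v) / 2 * ∫ s in v..w, x s ^ 2 := by
  have hI := intervalIntegrable_sub_mul_sq hx hx0
  have e : ∫ s in v..w, ((v + w) / 2 - s) * x s ^ 2 ≤
      ∫ s in v..w, ((v + w) / 2 - s) * x ((v + w) / 2) ^ 2 := by
    refine intervalIntegral.integral_mono_on h (hI _ _ _)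
      (Continuous.intervalIntegrable (by fun_prop) _ _) fun s _ => ?_
    rcases le_total s ((v + w) / 2) with hs | hs
    · exact mul_le_mul_of_nonneg_left (monotone_sq hx hx0 hs) (by linarith)
    · exact mul_le_mul_of_nonpos_left (monotone_sq hx hx0 hs) (by linarith)
  have e2 : ∫ s in v..w, ((v + w) / 2 - s) * x ((v + w) / 2) ^ 2 = 0 := by
    rw [intervalIntegral.integral_mul_const, intervalIntegral.integral_sub (by simp) (by simp)]
    simp
    left; ring
  have e3 : ∫ s in v..w, ((v + w) / 2 - s) * x s ^ 2 =
      (∫ s in v..w, (w - s) * x s ^ 2) - (w - v) / 2 * ∫ s in v..w, x s ^ 2 := by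
    rw [← intervalIntegral.integral_const_mul, ← intervalIntegral.integral_sub (hI _ _ _)
      ((monotone_sq hx hx0).intervalIntegrable.const_mul _)]
    refine intervalIntegral.integral_congr fun s _ => by ring
  linarith

lemma threshold_nonneg (hb0 : 0 < b) (hxa : ∀ p < a, x p = 0) (v : ℝ) :
    0 ≤ threshold x a b v := by
  have := sqMass_nonneg hxa v
  unfold threshold
  positivity

lemma threshold_of_le (hxa : ∀ p < a, x p = 0) {v : ℝ} (hv : v ≤ a) : threshold x a b v = 0 := by
  simp [threshold, sqMass_of_le hxa hv]

lemma threshold_mono (hx : Monotone x) (hx0 : ∀ p, 0 ≤ x p) (hxa : ∀ p < a, x p = 0)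
    (hb0 : 0 < b) : Monotone (threshold x a b) := by
  intro v w h
  rcases (sqMoment_nonneg hxa v).eq_or_lt with h1 | h1
  · have : threshold x a b v = 0 := by simp [threshold, ← h1]
    rw [this]
    exact threshold_nonneg hb0 hxa w
  have h2 := h1.trans_le (sqMoment_mono hx hx0 hxa h)
  have hM := sqMass_nonneg hxa v
  have hMw := sqMass_nonneg hxa w
  unfold threshold
  rw [div_le_div_iff₀ (by positivity) (by positivity)]
  suffices hs : sqMass x a v * √(sqMoment x a w) ≤ sqMass x a w * √(sqMoment x a v) by
    nlinarith
  refine le_of_sq_le_sq ?_ (by positivity)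
  rw [mul_pow, mul_pow, Real.sq_sqrt h1.le, Real.sq_sqrt h2.le]
  have hA : (w - v) * x v ^ 2 ≤ ∫ s in v..w, x s ^ 2 := by
    have : ∫ _ in v..w, x v ^ 2 = (w - v) * x v ^ 2 := by simp
    rw [← this]
    exact intervalIntegral.integral_mono_on h (by simp) (monotone_sq hx hx0).intervalIntegrable
      fun s hs => monotone_sq hx hx0 hs.1
  have hR := integral_sub_mul_sq_le hx hx0 h
  have hB := sqMass_sq_le hx hx0 hxa v
  rw [sqMoment_add hx hx0 v w, sqMass_add hx hx0 v w]
  set M := sqMass x a v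
  set Q := sqMoment x a v
  set A := ∫ s in v..w, x s ^ 2
  set R := ∫ s in v..w, (w - s) * x s ^ 2
  set d := w - v
  have hd : 0 ≤ d := sub_nonneg.2 h
  have hA0 : 0 ≤ A := le_trans (by positivity) hA
  have k1 : M ^ 2 * (Q + d * M + R) ≤ M ^ 2 * (Q + d * M + d / 2 * A) := by gcongr
  have k2 : d * M ^ 2 ≤ 2 * A * Q := by
    calc d * M ^ 2 ≤ d * (2 * x v ^ 2 * Q) := by gcongr
      _ = 2 * (d * x v ^ 2) * Q := by ring
      _ ≤ 2 * A * Q := by gcongr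
  have k3 := mul_le_mul_of_nonneg_right k2 hM
  have k4 := mul_le_mul_of_nonneg_right k2 hA0
  nlinarith

lemma threshold_le_half (hx : Monotone x) (hx0 : ∀ p, 0 ≤ x p) (hxa : ∀ p < a, x p = 0)
    (hb : b ^ 2 = 8 / 25) (v : ℝ) : threshold x a b v ≤ x v / 2 := by
  have hxv := hx0 v
  rcases (sqMoment_nonneg hxa v).eq_or_lt with h1 | h1
  · have : threshold x a b v = 0 := by simp [threshold, ← h1]
    linarith
  unfold threshold
  rw [div_le_iff₀ (by positivity)]
  refine le_of_sq_le_sq ?_ (by positivity)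
  rw [mul_pow, mul_pow, mul_pow, Real.sq_sqrt h1.le, hb]
  have hB := sqMass_sq_le hx hx0 hxa v
  have : 0 ≤ x v ^ 2 * sqMoment x a v := by positivity
  linarith

lemma hasDerivAt_sqMoment (hx : Monotone x) (hx0 : ∀ p, 0 ≤ x p) (hx1 : ∀ p, x p ≤ 1) (v : ℝ) :
    HasDerivAt (sqMoment x a) (sqMass x a v) v := by
  rw [hasDerivAt_iff_isLittleO]
  have hO : (fun w => sqMoment x a w - sqMoment x a v - (w - v) • sqMass x a v)
      =O[nhds v] fun w => (w - v) ^ 2 := by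
    refine Asymptotics.IsBigO.of_bound 1 (Filter.Eventually.of_forall fun w => ?_)
    rw [sqMoment_add hx hx0 v w, smul_eq_mul]
    have e : sqMoment x a v + (w - v) * sqMass x a v + (∫ s in v..w, (w - s) * x s ^ 2)
        - sqMoment x a v - (w - v) * sqMass x a v = ∫ s in v..w, (w - s) * x s ^ 2 := by ring
    rw [e]
    have := intervalIntegral.norm_integral_le_of_norm_le_const (a := v) (b := w)
      (f := fun s => (w - s) * x s ^ 2) (C := |w - v|) fun s hs => by
        rw [norm_mul, Real.norm_eq_abs, Real.norm_of_nonneg (sq_nonneg (x s))]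
        have h1 : |w - s| ≤ |w - v| := by
          rw [mem_uIoc] at hs
          rcases hs with hs | hs
          · rw [abs_of_nonneg (by linarith), abs_of_nonneg (by linarith)]; linarith
          · rw [abs_of_nonpos (by linarith), abs_of_nonpos (by linarith)]; linarith
        have h2 : x s ^ 2 ≤ 1 := pow_le_one₀ (hx0 s) (hx1 s)
        calc _ ≤ |w - v| * 1 := by gcongr
          _ = _ := mul_one _
    refine this.trans (le_of_eq ?_)
    rw [Real.norm_eq_abs, one_mul, abs_pow, sq]
  refine hO.trans_isLittleO ?_
  have := (Asymptotics.isLittleO_pow_id (𝕜 := ℝ) (n := 2) (by norm_num)).comp_tendsto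
    (show Filter.Tendsto (fun w => w - v) (nhds v) (nhds 0) by
      have : Filter.Tendsto (fun w => w - v) (nhds v) (nhds (v - v)) :=
        Filter.tendsto_id.sub_const v
      simpa using this)
  exact this

lemma integral_threshold_le (hx : Monotone x) (hx0 : ∀ p, 0 ≤ x p) (hx1 : ∀ p, x p ≤ 1)
    (hxa : ∀ p < a, x p = 0) (hb0 : 0 < b) {v : ℝ} (hv : a ≤ v) :
    ∫ s in a..v, threshold x a b s ≤ b * √(sqMoment x a v) := by
  have hQ := hasDerivAt_sqMoment (a := a) hx hx0 hx1
  have hQc : Continuous (sqMoment x a) :=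
    continuous_iff_continuousAt.2 fun t => (hQ t).continuousAt
  have hcomp : IsCompact (Icc a v ∩ sqMoment x a ⁻¹' {0}) :=
    isCompact_Icc.inter_right (isClosed_singleton.preimage hQc)
  obtain ⟨w, ⟨hw, hw0⟩, hmax⟩ := hcomp.exists_isGreatest
    ⟨a, left_mem_Icc.2 hv, sqMoment_of_le hxa le_rfl⟩
  have hw0 : sqMoment x a w = 0 := hw0
  have hI : ∀ s t, IntervalIntegrable (threshold x a b) volume s t := fun _ _ =>
    (threshold_mono hx hx0 hxa hb0).intervalIntegrable
  rw [← intervalIntegral.integral_add_adjacent_intervals (hI a w) (hI w v)]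
  have h1 : ∫ s in a..w, threshold x a b s = 0 := by
    rw [intervalIntegral.integral_congr (g := fun _ => 0), intervalIntegral.integral_zero]
    intro s hs
    rw [uIcc_of_le hw.1] at hs
    have : sqMoment x a s = 0 :=
      le_antisymm (hw0 ▸ sqMoment_mono hx hx0 hxa hs.2) (sqMoment_nonneg hxa s)
    simp [threshold, this]
  have h2 : ∫ s in w..v, threshold x a b s
      = b * √(sqMoment x a v) - b * √(sqMoment x a w) := by
    refine intervalIntegral.integral_eq_sub_of_hasDerivAt_of_le hw.2
      (f := fun t => b * √(sqMoment x a t)) (by fun_prop) (fun t ht => ?_) (hI w v)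
    have hne : sqMoment x a t ≠ 0 := fun h =>
      absurd (hmax ⟨⟨hw.1.trans ht.1.le, ht.2.le⟩, h⟩) (not_le.2 ht.1)
    exact (((hQ t).sqrt hne).const_mul b).congr_deriv (by rw [threshold]; ring)
  rw [h1, h2, hw0]
  simp

lemma integral_rescale {f : ℝ → ℝ} {k : ℝ} (hf : ∀ s < a, f s = 0)
    (hI : ∀ s t, IntervalIntegrable f volume s t) (hk : 0 < k) {v T : ℝ} (hT : v - k * T ≤ a) :
    ∫ W in (0 : ℝ)..T, f (v - k * W) = k⁻¹ * ∫ s in a..v, f s := by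
  rw [intervalIntegral.integral_comp_sub_mul f hk.ne' v, smul_eq_mul, mul_zero, sub_zero,
    integral_from_below hf hI hT]

/-- For every buyer value the buyer's proposer utility `U` and the seller's gain below the
threshold together cover the constant fraction `40 / 63` of the first best. -/
lemma pointwise_bound (hx : Monotone x) (hx0 : ∀ p, 0 ≤ x p)
    (hxa : ∀ p < a, x p = 0) (hb0 : 0 < b) (hb : b ^ 2 = 8 / 25) {v U : ℝ} (hv : a ≤ v)
    (hU : ∀ p, (v - p) * x p ≤ U) :
    40 / 63 * (∫ s in a..v, x s)
      ≤ (∫ s in a..v, min (x s) (threshold x a b v)) - b * √(sqMoment x a v) + U := by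
  have hU0 : 0 ≤ U := by simpa using hU v
  have hQ0 := sqMoment_nonneg (x := x) hxa v
  have hY0 := threshold_nonneg (x := x) hb0 hxa v
  have hmin0 : 0 ≤ ∫ s in a..v, min (x s) (threshold x a b v) :=
    intervalIntegral.integral_nonneg hv fun s _ => le_min (hx0 s) hY0
  by_cases hpos : ∃ p < v, 0 < x p
  swap
  · push Not at hpos
    have hz : ∀ p < v, x p = 0 := fun p hp => le_antisymm (hpos p hp) (hx0 p)
    rw [integral_eq_zero_of_zero_below hz hv le_rfl]
    have : sqMoment x a v = 0 :=
      integral_eq_zero_of_zero_below (fun s hs => by simp [hz s hs]) hv le_rfl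
    rw [this, Real.sqrt_zero]
    linarith
  obtain ⟨p, hpv, hp⟩ := hpos
  have hap : a ≤ p := by
    by_contra h
    exact hp.ne' (hxa p (not_le.1 h))
  have hUpos : 0 < U := (mul_pos (sub_pos.2 hpv) hp).trans_le (hU p)
  have hMpos : 0 < sqMass x a v := by
    rw [sqMass_add hx hx0 p v]
    have : ∫ _ in p..v, x p ^ 2 ≤ ∫ s in p..v, x s ^ 2 :=
      intervalIntegral.integral_mono_on hpv.le (by simp) (monotone_sq hx hx0).intervalIntegrable
        fun s hs => monotone_sq hx hx0 hs.1
    rw [intervalIntegral.integral_const, smul_eq_mul] at this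
    have h3 : 0 < (v - p) * x p ^ 2 := mul_pos (sub_pos.2 hpv) (by positivity)
    linarith [sqMass_nonneg (x := x) hxa p]
  have hQpos : 0 < sqMoment x a v := by
    refine hQ0.lt_of_ne fun h => ?_
    have := sqMass_sq_le hx hx0 hxa v
    rw [← h] at this
    nlinarith
  set Y := threshold x a b v with hYdef
  have hY : Y = b * sqMass x a v / (2 * √(sqMoment x a v)) := rfl
  set N := √(sqMoment x a v) with hN
  have hNpos : 0 < N := Real.sqrt_pos.2 hQpos
  have hNQ : N ^ 2 = sqMoment x a v := Real.sq_sqrt hQ0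
  have hYpos : 0 < Y := by rw [hY]; positivity
  obtain ⟨k, hk⟩ : ∃ k, k = U / Y := ⟨_, rfl⟩
  have hkpos : 0 < k := hk ▸ div_pos hUpos hYpos
  have hkY : k * Y = U := by rw [hk]; field_simp
  set T := max 1 ((v - a) / k) with hT
  have hT1 : 1 ≤ T := le_max_left _ _
  have hTa : v - k * T ≤ a := by
    have : (v - a) / k ≤ T := le_max_right _ _
    rw [div_le_iff₀ hkpos] at this
    linarith
  have hη : Antitone fun W => x (v - k * W) / Y := fun W W' h =>
    div_le_div_of_nonneg_right (hx (by nlinarith)) hYpos.le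
  have hη0 : ∀ W, 0 ≤ x (v - k * W) / Y := fun W => div_nonneg (hx0 _) hYpos.le
  have hWη : ∀ W ∈ Icc (0 : ℝ) T, W * (x (v - k * W) / Y) ≤ 1 := by
    intro W _
    rw [← mul_div_assoc, div_le_one hYpos]
    have := hU (v - k * W)
    rw [← hkY] at this
    have h2 : k * (W * x (v - k * W)) ≤ k * Y := by linarith
    exact le_of_mul_le_mul_left h2 hkpos
  have hJ : ∫ W in (0 : ℝ)..T, (x (v - k * W) / Y) ^ 2 = 2 * (N / U) / b := by
    rw [integral_rescale (f := fun s => (x s / Y) ^ 2) (fun s hs => by simp [hxa s hs])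
      (fun s t => by
        simp only [div_pow]
        exact (monotone_sq hx hx0).intervalIntegrable.div_const _) hkpos hTa]
    simp only [div_pow]
    rw [intervalIntegral.integral_div, ← sqMass, hk, hY]
    field_simp
  have hJW : ∫ W in (0 : ℝ)..T, W * (x (v - k * W) / Y) ^ 2 = (N / U) ^ 2 := by
    have e : ∀ W, W * (x (v - k * W) / Y) ^ 2
        = (fun s => (v - s) * x s ^ 2 / (k * Y ^ 2)) (v - k * W) := fun W => by
      simp only
      field_simp
      ring
    simp only [e]
    rw [integral_rescale (f := fun s => (v - s) * x s ^ 2 / (k * Y ^ 2))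
      (fun s hs => by simp [hxa s hs])
      (fun s t => (intervalIntegrable_sub_mul_sq hx hx0 v s t).div_const _) hkpos hTa,
      intervalIntegral.integral_div, ← sqMoment, ← hNQ, ← hkY]
    field_simp
  have h1 : ∫ W in (0 : ℝ)..T, x (v - k * W) / Y = (∫ s in a..v, x s) / U := by
    rw [integral_rescale (f := fun s => x s / Y) (fun s hs => by simp [hxa s hs])
      (fun s t => hx.intervalIntegrable.div_const _) hkpos hTa,
      intervalIntegral.integral_div, ← hkY]
    field_simp
  have h2 : ∫ W in (0 : ℝ)..T, min (x (v - k * W) / Y) 1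
      = (∫ s in a..v, min (x s) Y) / U := by
    have e : ∀ s, min (x s / Y) 1 = min (x s) Y / Y := fun s => by
      rw [← min_div_div_right hYpos.le, div_self hYpos.ne']
    simp only [e]
    rw [integral_rescale (f := fun s => min (x s) Y / Y) (fun s hs => by simp [hxa s hs, hYpos.le])
      (fun s t => (Monotone.intervalIntegrable
        fun _ _ h => min_le_min_right _ (hx h)).div_const _) hkpos hTa,
      intervalIntegral.integral_div, ← hkY]
    field_simp
  have key := antitone_integral_bound hη hη0 hT1 hWη hb hb0 hJ hJW
  rw [h1, h2] at key
  have := mul_le_mul_of_nonneg_right key hUpos.le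
  field_simp at this
  linarith

end Curve

section Acceptance

variable {c : ℝ → ℝ}

lemma accSet_subset (c : ℝ → ℝ) (p : ℝ) : {q : ℝ | q ∈ Icc (0 : ℝ) 1 ∧ c q ≤ p} ⊆ Icc 0 1 :=
  fun _ h => h.1

lemma accSet_ne_top (c : ℝ → ℝ) (p : ℝ) :
    volume {q : ℝ | q ∈ Icc (0 : ℝ) 1 ∧ c q ≤ p} ≠ ⊤ :=
  measure_ne_top_of_subset (accSet_subset c p) (by simp)

lemma accProb_nonneg (c : ℝ → ℝ) (p : ℝ) : 0 ≤ accProb c p := ENNReal.toReal_nonneg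

lemma accProb_le_one (c : ℝ → ℝ) (p : ℝ) : accProb c p ≤ 1 := by
  have := ENNReal.toReal_mono (by simp) (measure_mono (μ := volume) (accSet_subset c p))
  simpa [accProb] using this

lemma accProb_mono (c : ℝ → ℝ) : Monotone (accProb c) := fun _ p' h =>
  ENNReal.toReal_mono (accSet_ne_top c p') (measure_mono fun _ hq => ⟨hq.1, hq.2.trans h⟩)

lemma accProb_of_lt (hc : Monotone c) : ∀ p < c 0, accProb c p = 0 := by
  intro p hp
  have : {q : ℝ | q ∈ Icc (0 : ℝ) 1 ∧ c q ≤ p} = ∅ := by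
    ext q
    simp only [mem_ofPred_eq, mem_empty_iff_false, iff_false, not_and, not_le]
    exact fun hq => hp.trans_le (hc hq.1)
  simp only [accProb, this, measure_empty, ENNReal.toReal_zero]

lemma le_accProb (hc : Monotone c) {p q : ℝ} (hq : q ∈ Icc (0 : ℝ) 1) (h : c q ≤ p) :
    q ≤ accProb c p := by
  have := ENNReal.toReal_mono (accSet_ne_top c p) (measure_mono (μ := volume)
    (show Icc 0 q ⊆ _ from fun r hr => ⟨⟨hr.1, hr.2.trans hq.2⟩, (hc hr.2).trans h⟩))
  simpa [accProb, hq.1] using this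

lemma le_of_lt_accProb (hc : Monotone c) {p q : ℝ} (hq : 0 ≤ q) (h : q < accProb c p) :
    c q ≤ p := by
  by_contra hcon
  have := ENNReal.toReal_mono (by simp) (measure_mono (μ := volume)
    (show {r : ℝ | r ∈ Icc (0 : ℝ) 1 ∧ c r ≤ p} ⊆ Icc 0 q from fun r hr =>
      ⟨hr.1.1, le_of_not_gt fun hqr => hcon ((hc hqr.le).trans hr.2)⟩))
  rw [Real.volume_Icc, sub_zero, ENNReal.toReal_ofReal hq] at this
  exact absurd this (not_le.2 h)

lemma measureReal_restrict_cost_le (hc : Monotone c) {y : ℝ} (hy : y ∈ Icc (0 : ℝ) 1) (p : ℝ) :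
    (volume.restrict (Ioc 0 y)).real {q | c q ≤ p} = min (accProb c p) y := by
  have hm : 0 ≤ min (accProb c p) y := le_min (accProb_nonneg c p) hy.1
  have hms : MeasurableSet {q | c q ≤ p} := measurableSet_le hc.measurable measurable_const
  rw [measureReal_restrict_apply hms]
  apply le_antisymm
  · have h : {q | c q ≤ p} ∩ Ioc 0 y ⊆ Ioc 0 (min (accProb c p) y) := fun q hq =>
      ⟨hq.2.1, le_min (le_accProb hc ⟨hq.2.1.le, hq.2.2.trans hy.2⟩ hq.1) hq.2.2⟩
    have := measureReal_mono (μ := volume) h (by simp)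
    rwa [Real.volume_real_Ioc_of_le hm, sub_zero] at this
  · have h : Ioo 0 (min (accProb c p) y) ⊆ {q | c q ≤ p} ∩ Ioc 0 y := fun q hq =>
      ⟨le_of_lt_accProb hc hq.1.le (hq.2.trans_le (min_le_left _ _)),
        hq.1, hq.2.le.trans (min_le_right _ _)⟩
    have := measureReal_mono (μ := volume) h
      (measure_ne_top_of_subset inter_subset_right (by simp))
    rwa [Real.volume_real_Ioo_of_le hm, sub_zero] at this

lemma setIntegral_Ioi_comp_sub {f : ℝ → ℝ} {a v : ℝ} (hf : ∀ s < a, f s = 0) (hv : a ≤ v) :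
    ∫ t in Ioi (0 : ℝ), f (v - t) = ∫ s in a..v, f s := by
  have h := intervalIntegral.integral_comp_sub_left (a := 0) (b := v - a) f v
  rw [sub_sub_cancel, sub_zero] at h
  rw [← h, intervalIntegral.integral_of_le (by linarith)]
  refine setIntegral_eq_of_subset_of_forall_sdiff_eq_zero measurableSet_Ioi Ioc_subset_Ioi_self
    fun t ht => hf _ ?_
  by_contra hcon
  exact ht.2 ⟨ht.1, by linarith [not_lt.1 hcon]⟩

lemma integrableOn_max_sub_cost (hc : Monotone c) (v s t : ℝ) :
    IntegrableOn (fun q => max (v - c q) 0) (Ioc s t) := by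
  have : Antitone fun q => max (v - c q) 0 := fun _ _ h => max_le_max_right _ (by linarith [hc h])
  exact (this.antitoneOn _).integrableOn_isCompact (isCompact_Icc (a := s) (b := t))
    |>.mono_set Ioc_subset_Icc_self

lemma setIntegral_max_sub_cost (hc : Monotone c) {y : ℝ} (hy : y ∈ Icc (0 : ℝ) 1) {v : ℝ}
    (hv : c 0 ≤ v) :
    ∫ q in Ioc 0 y, max (v - c q) 0 = ∫ s in c 0..v, min (accProb c s) y := by
  rw [(integrableOn_max_sub_cost hc v 0 y).integral_eq_integral_meas_le
    (Filter.Eventually.of_forall fun q => le_max_right _ _),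
    ← setIntegral_Ioi_comp_sub (fun s hs => by simp [accProb_of_lt hc s hs, hy.1]) hv]
  refine setIntegral_congr_fun measurableSet_Ioi fun t ht => ?_
  have ht : 0 < t := ht
  rw [← measureReal_restrict_cost_le hc hy]
  congr 1
  ext q
  simp only [mem_ofPred_eq, le_max_iff, not_le.2 ht, or_false]
  exact le_sub_comm

lemma firstBest_eq (hc : Monotone c) {v : ℝ} (hv : c 0 ≤ v) :
    ∫ q in (0 : ℝ)..1, max (v - c q) 0 = ∫ s in c 0..v, accProb c s := by
  rw [intervalIntegral.integral_of_le zero_le_one, setIntegral_max_sub_cost hc (by simp) hv]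
  exact intervalIntegral.integral_congr fun s _ => min_eq_left (accProb_le_one c s)

lemma buyer_term_le (hc : Monotone c) (v p : ℝ) :
    (v - p) * accProb c p ≤ max (v - c 0) 0 := by
  rcases lt_or_ge p (c 0) with h | h
  · simp [accProb_of_lt hc p h]
  rcases le_total v p with h' | h'
  · exact (mul_nonpos_of_nonpos_of_nonneg (by linarith) (accProb_nonneg c p)).trans
      (le_max_right _ _)
  · refine le_trans ?_ (le_max_left _ _)
    calc _ ≤ (v - p) * 1 := mul_le_mul_of_nonneg_left (accProb_le_one c p) (by linarith)
      _ ≤ _ := by linarith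

lemma bddAbove_buyer (hc : Monotone c) (v : ℝ) :
    BddAbove (range fun p => (v - p) * accProb c p) :=
  ⟨_, forall_mem_range.2 (buyer_term_le hc v)⟩

lemma integrable_of_monotone_of_bound {ν : Measure ℝ} [IsProbabilityMeasure ν]
    (hν : Integrable (fun v : ℝ => v) ν) {f : ℝ → ℝ} (hf : Monotone f) (hf0 : ∀ v, 0 ≤ f v)
    {a : ℝ} (hfa : ∀ v, f v ≤ max (v - a) 0) : Integrable f ν := by
  refine Integrable.mono' (hν.norm.add (integrable_const |a|)) hf.measurable.aestronglyMeasurable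
    (Filter.Eventually.of_forall fun v => ?_)
  rw [Real.norm_of_nonneg (hf0 v)]
  refine (hfa v).trans (max_le ?_ ?_)
  · simp only [Pi.add_apply, Real.norm_eq_abs]
    linarith [le_abs_self v, neg_abs_le a]
  · simp only [Pi.add_apply, Real.norm_eq_abs]
    positivity

lemma integrable_buyer (hc : Monotone c) {ν : Measure ℝ} [IsProbabilityMeasure ν]
    (hν : Integrable (fun v : ℝ => v) ν) :
    Integrable (fun v => ⨆ p : ℝ, (v - p) * accProb c p) ν := by
  refine integrable_of_monotone_of_bound hν (a := c 0) (fun v w h => ?_) (fun v => ?_)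
    fun v => ciSup_le (buyer_term_le hc v)
  · exact ciSup_mono (bddAbove_buyer hc w) fun p =>
      mul_le_mul_of_nonneg_right (by linarith) (accProb_nonneg c p)
  · exact le_ciSup_of_le (bddAbove_buyer hc v) v (by simp)

lemma integrable_firstBest (hc : Monotone c) {ν : Measure ℝ} [IsProbabilityMeasure ν]
    (hν : Integrable (fun v : ℝ => v) ν) :
    Integrable (fun v => ∫ q in (0 : ℝ)..1, max (v - c q) 0) ν := by
  simp only [intervalIntegral.integral_of_le (zero_le_one (α := ℝ))]
  have hI := fun v => integrableOn_max_sub_cost hc v 0 1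
  refine integrable_of_monotone_of_bound hν (a := c 0) (fun v w h => ?_) (fun v => ?_) fun v => ?_
  · exact setIntegral_mono (hI v) (hI w) fun q => max_le_max_right _ (by linarith)
  · exact setIntegral_nonneg measurableSet_Ioc fun q _ => le_max_right _ _
  · have : ∫ _ in Ioc (0 : ℝ) 1, max (v - c 0) 0 = max (v - c 0) 0 := by simp
    rw [← this]
    exact setIntegral_mono_on (hI v) (by simp) measurableSet_Ioc fun q hq =>
      max_le_max_right _ (by linarith [hc hq.1.le])

end Acceptance

/-- The smallest value at which the increasing threshold `Y` reaches the quantile `q`. -/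
noncomputable def thresholdPrice (Y : ℝ → ℝ) (a q : ℝ) : ℝ := sInf {v | a ≤ v ∧ q ≤ Y v}

section Price

variable {Y : ℝ → ℝ} {a : ℝ}

lemma bddBelow_priceSet (Y : ℝ → ℝ) (a q : ℝ) : BddBelow {v | a ≤ v ∧ q ≤ Y v} :=
  ⟨a, fun _ h => h.1⟩

lemma thresholdPrice_le {q v : ℝ} (hv : a ≤ v) (h : q ≤ Y v) : thresholdPrice Y a q ≤ v :=
  csInf_le (bddBelow_priceSet Y a q) ⟨hv, h⟩

lemma le_thresholdPrice {q v : ℝ} (hv : a ≤ v) (h : q ≤ Y v) : a ≤ thresholdPrice Y a q :=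
  le_csInf ⟨v, hv, h⟩ fun _ h => h.1

lemma thresholdPrice_monotoneOn :
    MonotoneOn (thresholdPrice Y a) {q | ∃ v, a ≤ v ∧ q ≤ Y v} :=
  fun q _ _ hr h => csInf_le_csInf (bddBelow_priceSet Y a q) hr
    fun _ hv => ⟨hv.1, h.trans hv.2⟩

lemma aemeasurable_thresholdPrice (Y : ℝ → ℝ) (a : ℝ) (μ : Measure ℝ) :
    AEMeasurable (thresholdPrice Y a) μ := by
  set D := {q | ∃ v, a ≤ v ∧ q ≤ Y v} with hD
  have hDm : MeasurableSet D := by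
    refine OrdConnected.measurableSet ⟨fun p _ q hq r hr => ?_⟩
    obtain ⟨v, hv, h⟩ := hq
    exact ⟨v, hv, hr.2.trans h⟩
  have e : thresholdPrice Y a = D.indicator (thresholdPrice Y a) := by
    ext q
    by_cases hq : q ∈ D
    · rw [indicator_of_mem hq]
    · rw [indicator_of_notMem hq, thresholdPrice]
      convert Real.sInf_empty
      ext v
      exact ⟨fun h => hq ⟨v, h⟩, fun h => h.elim⟩
  rw [e, aemeasurable_indicator_iff hDm]
  exact aemeasurable_restrict_of_monotoneOn hDm thresholdPrice_monotoneOn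

lemma setIntegral_sub_thresholdPrice_le (hY : Monotone Y) (hYa : ∀ s < a, Y s = 0)
    (hY0 : ∀ s, 0 ≤ Y s) {v : ℝ} (hv : a ≤ v) :
    IntegrableOn (thresholdPrice Y a) (Ioc 0 (Y v)) ∧
    ∫ q in Ioc 0 (Y v), (v - thresholdPrice Y a q) ≤ ∫ s in a..v, Y s := by
  have hP : IntegrableOn (thresholdPrice Y a) (Ioc 0 (Y v)) := by
    refine IntegrableOn.mono_set ?_ (Ioc_subset_Icc_self (a := 0) (b := Y v))
    refine MonotoneOn.integrableOn_isCompact isCompact_Icc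
      (thresholdPrice_monotoneOn.mono fun q hq => ⟨v, hv, hq.2⟩)
  refine ⟨hP, ?_⟩
  have hI : IntegrableOn (fun q => v - thresholdPrice Y a q) (Ioc 0 (Y v)) :=
    (integrable_const v).sub hP
  rw [hI.integral_eq_integral_meas_lt, ← setIntegral_Ioi_comp_sub hYa hv]
  swap
  · filter_upwards [ae_restrict_mem measurableSet_Ioc] with q hq
    exact sub_nonneg.2 (thresholdPrice_le hv hq.2)
  have hYI : IntegrableOn (fun t => Y (v - t)) (Ioi 0) := by
    have hanti : Antitone fun t => Y (v - t) := fun _ _ h => hY (by linarith)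
    refine IntegrableOn.of_forall_sdiff_eq_zero (s := Icc 0 (v - a))
      ((hanti.antitoneOn _).integrableOn_isCompact isCompact_Icc) measurableSet_Ioi
      fun t ht => hYa _ ?_
    by_contra hcon
    exact ht.2 ⟨(mem_Ioi.1 ht.1).le, by linarith [not_lt.1 hcon]⟩
  refine integral_mono_of_nonneg (Filter.Eventually.of_forall fun t => measureReal_nonneg) hYI ?_
  filter_upwards [ae_restrict_mem measurableSet_Ioi] with t _
  have hsub : {q | t < v - thresholdPrice Y a q} ∩ Ioc 0 (Y v) ⊆ Ioc 0 (Y (v - t)) := by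
    intro q hq
    have h1 : t < v - thresholdPrice Y a q := hq.1
    obtain ⟨w, hw, hwv⟩ := exists_lt_of_csInf_lt (s := {v | a ≤ v ∧ q ≤ Y v}) ⟨v, hv, hq.2.2⟩
      (show sInf {v | a ≤ v ∧ q ≤ Y v} < v - t from by
        change thresholdPrice Y a q < v - t
        linarith)
    exact ⟨hq.2.1, hw.2.trans (hY hwv.le)⟩
  rw [measureReal_restrict_apply' measurableSet_Ioc]
  have := measureReal_mono (μ := volume) hsub (by simp)
  rwa [Real.volume_real_Ioc_of_le (hY0 _), sub_zero] at this

end Price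

section Seller

variable {c : ℝ → ℝ} {ν : Measure ℝ} [IsProbabilityMeasure ν]

lemma seller_term_le (hν : Integrable (fun v : ℝ => v) ν) (C p : ℝ) :
    (p - C) * (ν {v : ℝ | p ≤ v}).toReal ≤ ∫ v, max (v - C) 0 ∂ν := by
  rcases le_total p C with h | h
  · exact (mul_nonpos_of_nonpos_of_nonneg (by linarith) ENNReal.toReal_nonneg).trans
      (integral_nonneg fun v => le_max_right _ _)
  · have hI : Integrable (fun v => max (v - C) 0) ν := (hν.sub (integrable_const C)).pos_part
    refine le_trans ?_ (mul_meas_ge_le_integral_of_nonneg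
      (Filter.Eventually.of_forall fun v => le_max_right _ _) hI (p - C))
    refine mul_le_mul_of_nonneg_left ?_ (by linarith)
    exact measureReal_mono fun v hv => (sub_le_sub_right hv C).trans (le_max_left _ _)

lemma bddAbove_seller (hν : Integrable (fun v : ℝ => v) ν) (C : ℝ) :
    BddAbove (range fun p => (p - C) * (ν {v : ℝ | p ≤ v}).toReal) :=
  ⟨_, forall_mem_range.2 (seller_term_le hν C)⟩

lemma intervalIntegrable_seller (hc : Monotone c) (hν : Integrable (fun v : ℝ => v) ν) (s t : ℝ) :
    IntervalIntegrable (fun q => ⨆ p : ℝ, (p - c q) * (ν {v : ℝ | p ≤ v}).toReal) volume s t :=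
  Antitone.intervalIntegrable fun _ _ h => ciSup_mono (bddAbove_seller hν _) fun _ =>
    mul_le_mul_of_nonneg_right (by linarith [hc h]) ENNReal.toReal_nonneg

lemma price_mul_measure_le_seller (hν : Integrable (fun v : ℝ => v) ν) {A : Set ℝ} {P : ℝ}
    (hA : ∀ v ∈ A, P ≤ v) (C : ℝ) :
    (P - C) * ν.real A ≤ ⨆ p : ℝ, (p - C) * (ν {v : ℝ | p ≤ v}).toReal := by
  rcases le_total P C with h | h
  · exact (mul_nonpos_of_nonpos_of_nonneg (by linarith) measureReal_nonneg).trans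
      (le_ciSup_of_le (bddAbove_seller hν C) C (by simp))
  · exact le_ciSup_of_le (bddAbove_seller hν C) P
      (mul_le_mul_of_nonneg_left (measureReal_mono hA) (by linarith))

/-- The seller's profit against value `v` when the quantiles up to `Y v` trade at their
threshold prices. -/
noncomputable def thresholdProfit (c Y : ℝ → ℝ) (v : ℝ) : ℝ :=
  ∫ q in Ioc 0 (Y v), (thresholdPrice Y (c 0) q - c q)

lemma thresholdProfit_le (hc : Monotone c) (hν : Integrable (fun v : ℝ => v) ν) {Y : ℝ → ℝ}
    (hY : Monotone Y) (hYa : ∀ s < c 0, Y s = 0) (hY1 : ∀ s, Y s ≤ 1) :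
    Integrable (thresholdProfit c Y) ν ∧ ∫ v, thresholdProfit c Y v ∂ν ≤ uS c ν := by
  set P := thresholdPrice Y (c 0) with hP
  set μ := (volume : Measure ℝ).restrict (Ioc 0 1) with hμ
  set E : Set (ℝ × ℝ) := {z | z.1 ≤ Y z.2} with hE
  have hEm : MeasurableSet E :=
    measurableSet_le measurable_fst (hY.measurable.comp measurable_snd)
  set f : ℝ × ℝ → ℝ := E.indicator fun z => P z.1 - c z.1 with hf
  have hfm : AEStronglyMeasurable f (μ.prod ν) := by
    refine AEStronglyMeasurable.indicator ?_ hEm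
    exact ((aemeasurable_thresholdPrice Y (c 0) μ).sub hc.measurable.aemeasurable).comp_fst
      |>.aestronglyMeasurable
  have hval : ∀ q v : ℝ, 0 < q → q ≤ Y v → c 0 ≤ v := fun q v hq h => by
    by_contra hcon
    rw [hYa v (not_le.1 hcon)] at h
    exact absurd h (not_le.2 hq)
  have hfst : ∀ᵐ z ∂(μ.prod ν), z.1 ∈ Ioc (0 : ℝ) 1 :=
    Measure.quasiMeasurePreserving_fst.ae (ae_restrict_mem measurableSet_Ioc)
  have hbound : ∀ᵐ z ∂(μ.prod ν), ‖f z‖ ≤ ‖z.2‖ + (2 * |c 0| + |c 1|) := by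
    filter_upwards [hfst] with z hz
    by_cases hzE : z ∈ E
    · have hzE' : z.1 ≤ Y z.2 := hzE
      have hav := hval _ _ hz.1 hzE'
      rw [hf, indicator_of_mem hzE, Real.norm_eq_abs, Real.norm_eq_abs, abs_le]
      have h1 : P z.1 ≤ z.2 := thresholdPrice_le hav hzE'
      have h2 : c 0 ≤ P z.1 := le_thresholdPrice hav hzE'
      have h3 := hc hz.1.le
      have h4 := hc hz.2
      constructor <;> linarith [le_abs_self z.2, neg_abs_le (c 0), le_abs_self (c 1),
        le_abs_self (c 0), neg_abs_le z.2, abs_nonneg (c 0), abs_nonneg (c 1), abs_nonneg z.2]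
    · rw [hf, indicator_of_notMem hzE, norm_zero]
      positivity
  have hfi : Integrable f (μ.prod ν) := by
    refine Integrable.mono' (g := fun z => ‖z.2‖ + (2 * |c 0| + |c 1|)) ?_ hfm hbound
    exact (Integrable.comp_snd hν.norm μ).add (integrable_const _)
  have hprofit : ∀ v, ∫ q, f (q, v) ∂μ = thresholdProfit c Y v := by
    intro v
    have : (fun q => f (q, v)) = (Iic (Y v)).indicator fun q => P q - c q := rfl
    rw [this, integral_indicator measurableSet_Iic, hμ, Measure.restrict_restrict measurableSet_Iic,
      thresholdProfit]
    congr 2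
    ext q
    exact ⟨fun h => ⟨h.2.1, h.1⟩, fun h => ⟨h.2, h.1, h.2.trans (hY1 v)⟩⟩
  refine ⟨?_, ?_⟩
  · simpa only [hprofit] using hfi.integral_prod_right
  · simp only [← hprofit]
    rw [← integral_integral_swap (f := fun q v => f (q, v)) hfi, uS,
      intervalIntegral.integral_of_le zero_le_one]
    refine integral_mono_ae hfi.integral_prod_left
      ((intervalIntegrable_iff_integrableOn_Ioc_of_le zero_le_one).1
        (intervalIntegrable_seller hc hν 0 1)) ?_
    filter_upwards [ae_restrict_mem measurableSet_Ioc] with q hq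
    have hAm : MeasurableSet {v | q ≤ Y v} := measurableSet_le measurable_const hY.measurable
    have : (fun v => f (q, v)) = {v | q ≤ Y v}.indicator fun _ => P q - c q := rfl
    rw [this, integral_indicator_const _ hAm, smul_eq_mul, mul_comm]
    exact price_mul_measure_le_seller hν
      (fun v hv => thresholdPrice_le (hval q v hq.1 hv) hv) (c q)

end Seller

section Main

variable {c : ℝ → ℝ}

lemma le_thresholdProfit (hc : Monotone c) {b : ℝ} (hb0 : 0 < b) (hb : b ^ 2 = 8 / 25) {v : ℝ}
    (hv : c 0 ≤ v) :
    (∫ s in c 0..v, min (accProb c s) (threshold (accProb c) (c 0) b v))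
      - b * √(sqMoment (accProb c) (c 0) v)
      ≤ thresholdProfit c (threshold (accProb c) (c 0) b) v := by
  have hx := accProb_mono c
  have hx0 := accProb_nonneg c
  have hx1 := accProb_le_one c
  have hxa := accProb_of_lt hc
  set x := accProb c
  set Y := threshold x (c 0) b
  have hY0 : ∀ s, 0 ≤ Y s := threshold_nonneg hb0 hxa
  have hYx : Y v ≤ x v / 2 := threshold_le_half hx hx0 hxa hb v
  obtain ⟨hP, hle⟩ := setIntegral_sub_thresholdPrice_le (threshold_mono hx hx0 hxa hb0)
    (fun s hs => threshold_of_le hxa hs.le) hY0 hv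
  have hY1 : Y v ≤ 1 := by linarith [hx0 v, hx1 v]
  rw [← setIntegral_max_sub_cost hc ⟨hY0 v, hY1⟩ hv]
  have e : thresholdProfit c Y v = (∫ q in Ioc 0 (Y v), max (v - c q) 0)
      - ∫ q in Ioc 0 (Y v), (v - thresholdPrice Y (c 0) q) := by
    have hI : IntegrableOn (fun q => v - thresholdPrice Y (c 0) q) (Ioc 0 (Y v)) :=
      (integrable_const v).sub hP
    rw [← integral_sub (integrableOn_max_sub_cost hc v 0 (Y v)) hI, thresholdProfit]
    refine setIntegral_congr_fun measurableSet_Ioc fun q hq => ?_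
    have : c q ≤ v := le_of_lt_accProb hc hq.1.le
      (show q < x v by linarith [hq.1, hq.2, hx0 v])
    rw [max_eq_left (by linarith)]
    ring
  rw [e]
  linarith [integral_threshold_le hx hx0 hx1 hxa hb0 hv]

lemma firstBest_le_of_monotone (hc : Monotone c) {ν : Measure ℝ} [IsProbabilityMeasure ν]
    (hν : Integrable (fun v : ℝ => v) ν) : 40 / 63 * FB c ν ≤ uB c ν + uS c ν := by
  obtain ⟨b, hb0, hb⟩ : ∃ b : ℝ, 0 < b ∧ b ^ 2 = 8 / 25 :=
    ⟨√(8 / 25), by positivity, Real.sq_sqrt (by norm_num)⟩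
  have hx := accProb_mono c
  have hx0 := accProb_nonneg c
  have hxa := accProb_of_lt hc
  set Y := threshold (accProb c) (c 0) b with hY
  have hY1 : ∀ s, Y s ≤ 1 := fun s => by
    linarith [threshold_le_half hx hx0 hxa hb s, accProb_le_one c s, hx0 s]
  obtain ⟨hpI, hp⟩ := thresholdProfit_le hc hν (threshold_mono hx hx0 hxa hb0)
    (fun s hs => threshold_of_le hxa hs.le) hY1
  refine le_trans ?_ (add_le_add_right hp (uB c ν))
  rw [FB, uB, ← integral_const_mul, ← integral_add (integrable_buyer hc hν) hpI]
  refine integral_mono ((integrable_firstBest hc hν).const_mul _)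
    ((integrable_buyer hc hν).add hpI) fun v => ?_
  simp only
  rcases le_total (c 0) v with hv | hv
  · rw [firstBest_eq hc hv]
    have := pointwise_bound hx hx0 hxa hb0 hb hv (fun p => le_ciSup (bddAbove_buyer hc v) p)
    linarith [le_thresholdProfit hc hb0 hb hv]
  · have h1 : ∫ q in (0 : ℝ)..1, max (v - c q) 0 = 0 := by
      rw [intervalIntegral.integral_congr (g := fun _ => 0), intervalIntegral.integral_zero]
      intro q hq
      rw [uIcc_of_le zero_le_one] at hq
      exact max_eq_right (by linarith [hc hq.1])
    have h2 : thresholdProfit c Y v = 0 := by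
      simp [thresholdProfit, hY, threshold_of_le hxa hv]
    rw [h1, h2, mul_zero, add_zero]
    exact le_ciSup_of_le (bddAbove_buyer hc v) v (by simp)

end Main

theorem stmt9 (c : ℝ → ℝ) (hc : MonotoneOn c (Icc (0:ℝ) 1))
    (ν : Measure ℝ) [IsProbabilityMeasure ν]
    (hν : Integrable (fun v : ℝ => v) ν) :
    (uB c ν + uS c ν) / 2 ≥ FB c ν / 3.15 := by
  set d : ℝ → ℝ := IccExtend zero_le_one fun q : Icc (0 : ℝ) 1 => c q with hd
  have hdm : Monotone d := fun p q h =>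
    hc (projIcc 0 1 zero_le_one p).2 (projIcc 0 1 zero_le_one q).2 (monotone_projIcc _ h)
  have hdc : ∀ q ∈ Icc (0 : ℝ) 1, d q = c q := fun q hq => by
    rw [hd, IccExtend_of_mem _ _ hq]
  have hdc' : ∀ q ∈ uIcc (0 : ℝ) 1, d q = c q := by rwa [uIcc_of_le zero_le_one]
  have hacc : accProb d = accProb c := by
    ext p
    rw [accProb, accProb]
    congr 2
    ext q
    exact and_congr_right fun hq => by rw [hdc q hq]
  have hB : uB d ν = uB c ν := by rw [uB, uB, hacc]
  have hS : uS d ν = uS c ν := intervalIntegral.integral_congr fun q hq => by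
    simp only [hdc' q hq]
  have hF : FB d ν = FB c ν := integral_congr_ae (Filter.Eventually.of_forall fun v =>
    intervalIntegral.integral_congr fun q hq => by simp only [hdc' q hq])
  have := firstBest_le_of_monotone hdm hν
  rw [hB, hS, hF] at this
  norm_num
  linarith
end
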